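/- arXiv:2007.03110 — 5 statements merged into one kernel-verified Lean document; each statement's English description precedes it below -/
import Mathlib

section
/- For all integers a ≥ 0 and b ≥ 1, the Schur module L_b^a(F) is a free R-module of rank binom(n+b-1, a+b) · binom(a+b-1, a). -/
open Finset MvPolynomial

noncomputable section

variable (K : Type) [Field K] (n : ℕ)

/-- The polynomial ring `R = k[x_1, …, x_n]`. -/
abbrev Rp : Type := MvPolynomial (Fin n) K

/-- Basis indexing set for `Λ^a F ⊗ S_b F`: a subset of size `a` (the column of the
exterior factor, in increasing order) and a multiset of size `b` (the symmetric factor). -/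
abbrev EB (a b : ℕ) : Type := {s : Finset (Fin n) // s.card = a} × Sym (Fin n) b

/-- The free module `Λ^a F ⊗_R S_b F` where `F = R^n`. -/
abbrev Emod (a b : ℕ) : Type := EB n a b →₀ Rp K n

/-- The map `κ_{a,b} : Λ^a F ⊗ S_b → Λ^{a-1} F ⊗ S_{b+1}`, the composition of exterior
comultiplication with symmetric multiplication (identifying `F = S_1 F`).  On basis
elements it sends `e_{i_1} ∧ ⋯ ∧ e_{i_a} ⊗ m` (with `i_1 < ⋯ < i_a`) to
`Σ_k (-1)^{k-1} e_{i_1} ∧ ⋯ ∧ ê_{i_k} ∧ ⋯ ∧ e_{i_a} ⊗ (i_k · m)`. -/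
def kappa (a b : ℕ) : Emod K n a b →ₗ[Rp K n] Emod K n (a-1) (b+1) :=
  Finsupp.lift _ _ _ fun p =>
    ∑ i ∈ p.1.1.attach,
      ((-1 : Rp K n) ^ (p.1.1.filter (fun j => j < i.1)).card) •
        Finsupp.single
          (⟨p.1.1.erase i.1, by rw [Finset.card_erase_of_mem i.2, p.1.2]⟩, i.1 ::ₛ p.2) 1

/-- The Schur module `L_b^a(F) := ker κ_{a,b}` (for `a = 0` the map `κ_{0,b}` is zero,
so this is all of `S_b(F)`, agreeing with the convention `L_b^0(F) = S_b(F)`). -/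
def Lmod (a b : ℕ) : Submodule (Rp K n) (Emod K n a b) :=
  LinearMap.ker (kappa K n a b)

section Helpers

abbrev QQ : Type := Finset (Fin n) × Multiset (Fin n)

abbrev GG : Type := QQ n →₀ Rp K n

def sg (s : Finset (Fin n)) (i : Fin n) : Rp K n := (-1) ^ (s.filter (fun j => j < i)).card

def DD : GG K n →ₗ[Rp K n] GG K n :=
  Finsupp.lift _ _ _ fun q => ∑ i ∈ q.1, sg K n q.1 i • Finsupp.single (q.1.erase i, i ::ₘ q.2) 1

def PP (i : Fin n) (q : QQ n) : Prop := i ∈ q.2 ∧ (∀ j ∈ q.1, i < j) ∧ ∀ j ∈ q.2, i ≤ j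

open Classical in
def Hb (q : QQ n) : GG K n :=
  if h : ∃ i, PP n i q then Finsupp.single (insert h.choose q.1, q.2.erase h.choose) 1 else 0

def HH : GG K n →ₗ[Rp K n] GG K n := Finsupp.lift _ _ _ (Hb K n)

lemma DD_single (q : QQ n) : DD K n (Finsupp.single q 1) =
    ∑ i ∈ q.1, sg K n q.1 i • Finsupp.single (q.1.erase i, i ::ₘ q.2) 1 := by
  simp [DD]

lemma HH_single (q : QQ n) : HH K n (Finsupp.single q 1) = Hb K n q := by
  simp [HH]

lemma PP_unique {i j : Fin n} {q : QQ n} (hi : PP n i q) (hj : PP n j q) : i = j :=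
  le_antisymm (hi.2.2 _ hj.1) (hj.2.2 _ hi.1)

lemma Hb_of {i : Fin n} {q : QQ n} (h : PP n i q) :
    Hb K n q = Finsupp.single (insert i q.1, q.2.erase i) 1 := by
  have h' : ∃ i, PP n i q := ⟨i, h⟩
  have e : h'.choose = i := PP_unique n h'.choose_spec h
  rw [Hb, dif_pos h', e]

lemma Hb_not {q : QQ n} (h : ¬ ∃ i, PP n i q) : Hb K n q = 0 := by
  rw [Hb, dif_neg h]

lemma sg_swap_lt (s : Finset (Fin n)) {i j : Fin n} (hi : i ∈ s) (h : i < j) :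
    sg K n s i * sg K n (s.erase i) j + sg K n s j * sg K n (s.erase j) i = 0 := by
  unfold sg
  have e1 : (s.erase j).filter (fun k => k < i) = s.filter (fun k => k < i) := by
    ext k; simp only [Finset.mem_filter, Finset.mem_erase]
    constructor
    · rintro ⟨⟨_, a⟩, b⟩; exact ⟨a, b⟩
    · rintro ⟨a, b⟩; exact ⟨⟨(b.trans h).ne, a⟩, b⟩
  have e2 : (s.filter (fun k => k < j)).card =
      ((s.erase i).filter (fun k => k < j)).card + 1 := by
    rw [Finset.filter_erase, Finset.card_erase_add_one]
    simp [hi, h]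
  rw [e1, e2, pow_succ]; ring

lemma sg_swap (s : Finset (Fin n)) {i j : Fin n} (hi : i ∈ s) (hj : j ∈ s) (h : i ≠ j) :
    sg K n s i * sg K n (s.erase i) j + sg K n s j * sg K n (s.erase j) i = 0 := by
  rcases lt_or_gt_of_ne h with h | h
  · exact sg_swap_lt K n s hi h
  · rw [add_comm]; exact sg_swap_lt K n s hj h

lemma DD_DD (x : GG K n) : DD K n (DD K n x) = 0 := by
  suffices h : (DD K n).comp (DD K n) = 0 from LinearMap.congr_fun h x
  ext1 q
  ext1
  simp only [LinearMap.comp_apply, Finsupp.lsingle_apply, LinearMap.zero_apply]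
  rw [DD_single, map_sum]
  simp only [map_smul, DD_single, Finset.smul_sum, smul_smul]
  rw [Finset.sum_sigma']
  refine Finset.sum_involution (fun p _ => ⟨p.2, p.1⟩) ?_ ?_ ?_ ?_
  · rintro ⟨i, j⟩ hp
    simp only [Finset.mem_sigma, Finset.mem_erase] at hp
    obtain ⟨hi, hji, hj⟩ := hp
    simp only
    rw [Finset.erase_right_comm (a := j) (b := i), Multiset.cons_swap i j, ← add_smul,
      sg_swap K n q.1 hi hj (Ne.symm hji), zero_smul]
  · rintro ⟨i, j⟩ hp _
    simp only [Finset.mem_sigma, Finset.mem_erase] at hp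
    intro e
    have := congrArg Sigma.fst e
    exact hp.2.1 this
  · rintro ⟨i, j⟩ hp
    simp only [Finset.mem_sigma, Finset.mem_erase] at hp ⊢
    exact ⟨hp.2.2, Ne.symm hp.2.1, hp.1⟩
  · rintro ⟨i, j⟩ hp
    rfl

lemma sg_min (s : Finset (Fin n)) (i : Fin n) (h : ∀ j ∈ s, i ≤ j) : sg K n s i = 1 := by
  have : s.filter (fun j => j < i) = ∅ := by
    apply Finset.filter_eq_empty_iff.2
    intro j hj
    exact not_lt.2 (h j hj)
  simp [sg, this]

lemma sg_insert (s : Finset (Fin n)) {M i : Fin n} (hM : M ∉ s) (h : M < i) :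
    sg K n (insert M s) i = - sg K n s i := by
  unfold sg
  rw [Finset.filter_insert, if_pos h, Finset.card_insert_of_notMem (by simp [hM]), pow_succ]
  ring

lemma homotopy_basis (q : QQ n) (hne : (q.1 ∪ q.2.toFinset).Nonempty) :
    DD K n (HH K n (Finsupp.single q 1)) + HH K n (DD K n (Finsupp.single q 1)) =
      Finsupp.single q 1 := by
  obtain ⟨s, m⟩ := q
  obtain ⟨M, hM, hmin⟩ := (s ∪ m.toFinset).exists_min_image id hne
  have hs : ∀ j ∈ s, M ≤ j := fun j hj => hmin j (by simp [hj])
  have hm : ∀ j ∈ m, M ≤ j := fun j hj => hmin j (by simp [hj])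
  rw [HH_single, DD_single, map_sum]
  simp only [map_smul, HH_single]
  by_cases hMs : M ∈ s
  · rw [Hb_not, map_zero, zero_add, Finset.sum_eq_single_of_mem M hMs]
    · rw [sg_min K n s M hs, one_smul, Hb_of K n (i := M)]
      · simp [Finset.insert_erase hMs]
      · refine ⟨by simp, ?_, ?_⟩
        · intro j hj
          simp only [Finset.mem_erase] at hj
          exact lt_of_le_of_ne (hs j hj.2) (Ne.symm hj.1)
        · intro j hj
          simp only [Multiset.mem_cons] at hj
          rcases hj with rfl | hj
          · exact le_rfl
          · exact hm j hj
    · intro i hi hiM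
      rw [Hb_not, smul_zero]
      rintro ⟨k, hk1, hk2, -⟩
      have h1 : k < M := hk2 M (by simp [hMs, Ne.symm hiM])
      simp only [Multiset.mem_cons] at hk1
      rcases hk1 with rfl | hk1
      · exact absurd (hs _ hi) (not_le.2 h1)
      · exact absurd (hm _ hk1) (not_le.2 h1)
    · rintro ⟨k, hk1, hk2, -⟩
      exact absurd (hm _ hk1) (not_le.2 (hk2 M hMs))
  · have hMm : M ∈ m := by simpa [hMs] using hM
    have hlt : ∀ j ∈ s, M < j := fun j hj =>
      lt_of_le_of_ne (hs j hj) (fun e => hMs (e ▸ hj))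
    rw [Hb_of K n (i := M) ⟨hMm, hlt, hm⟩, DD_single]
    simp only
    rw [Finset.sum_insert hMs, Finset.erase_insert hMs, Multiset.cons_erase hMm,
      sg_min K n _ M (by simpa using hs), one_smul, add_assoc, ← Finset.sum_add_distrib,
      Finset.sum_eq_zero, add_zero]
    intro i hi
    have hne : M ≠ i := (hlt i hi).ne
    rw [Hb_of K n (i := M), sg_insert K n s hMs (hlt i hi)]
    · simp only
      rw [Finset.erase_insert_of_ne hne, Multiset.erase_cons_tail _ (Ne.symm hne), neg_smul,
        neg_add_cancel]
    · refine ⟨by simp [hMm], ?_, ?_⟩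
      · intro j hj
        exact hlt j (Finset.mem_of_mem_erase hj)
      · intro j hj
        simp only [Multiset.mem_cons] at hj
        rcases hj with rfl | hj
        · exact hs _ hi
        · exact hm j hj

def jj (a b : ℕ) (p : EB n a b) : QQ n := (p.1.1, (p.2 : Multiset (Fin n)))

lemma jj_inj (a b : ℕ) : Function.Injective (jj n a b) := by
  rintro ⟨⟨s, hs⟩, ⟨m, hm⟩⟩ ⟨⟨s', hs'⟩, ⟨m', hm'⟩⟩ h
  simp only [jj, Prod.mk.injEq] at h
  obtain ⟨h1, h2⟩ := h
  subst h1
  have : m = m' := h2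
  subst this
  rfl

def io (a b : ℕ) : Emod K n a b →ₗ[Rp K n] GG K n := Finsupp.lmapDomain _ _ (jj n a b)

lemma io_inj (a b : ℕ) : Function.Injective (io K n a b) :=
  Finsupp.mapDomain_injective (jj_inj n a b)

lemma io_single (a b : ℕ) (p : EB n a b) :
    io K n a b (Finsupp.single p 1) = Finsupp.single (jj n a b p) 1 := by
  simp [io]

lemma io_apply (a b : ℕ) (x : Emod K n a b) (p : EB n a b) :
    io K n a b x (jj n a b p) = x p :=
  Finsupp.mapDomain_apply (jj_inj n a b) x p

lemma io_kappa (a b : ℕ) (x : Emod K n a b) :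
    io K n (a-1) (b+1) (kappa K n a b x) = DD K n (io K n a b x) := by
  suffices h : (io K n (a-1) (b+1)).comp (kappa K n a b) = (DD K n).comp (io K n a b) from
    LinearMap.congr_fun h x
  ext1 p
  ext1
  simp only [LinearMap.comp_apply, Finsupp.lsingle_apply]
  rw [io_single, DD_single]
  have : kappa K n a b (Finsupp.single p 1) = ∑ i ∈ p.1.1.attach,
      ((-1 : Rp K n) ^ (p.1.1.filter (fun j => j < i.1)).card) •
        Finsupp.single
          (⟨p.1.1.erase i.1, by rw [Finset.card_erase_of_mem i.2, p.1.2]⟩, i.1 ::ₛ p.2) 1 := by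
    simp [kappa]
  rw [this, map_sum]
  simp only [map_smul, io_single]
  rw [← Finset.sum_attach (jj n a b p).1]
  rfl

lemma mem_Lmod (a b : ℕ) (x : Emod K n a b) : x ∈ Lmod K n a b ↔ DD K n (io K n a b x) = 0 := by
  rw [← io_kappa, Lmod, LinearMap.mem_ker]
  constructor
  · intro h; rw [h, map_zero]
  · intro h; exact io_inj K n _ _ (by rw [h, map_zero])

lemma homotopy_gen (a b : ℕ) (hab : 0 < a + b) (x : Emod K n a b) :
    DD K n (HH K n (io K n a b x)) + HH K n (DD K n (io K n a b x)) =
      io K n a b x := by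
  suffices h : ((DD K n).comp (HH K n) + (HH K n).comp (DD K n)).comp (io K n a b) =
      io K n a b from LinearMap.congr_fun h x
  ext1 p
  ext1
  simp only [LinearMap.comp_apply, Finsupp.lsingle_apply, LinearMap.add_apply]
  rw [io_single, homotopy_basis]
  by_contra h
  rw [Finset.not_nonempty_iff_eq_empty, Finset.union_eq_empty, Multiset.toFinset_eq_empty] at h
  have h1 : (jj n a b p).1.card = a := p.1.2
  have h2 : Multiset.card (jj n a b p).2 = b := p.2.2
  rw [h.1] at h1
  rw [h.2] at h2
  simp at h1 h2
  omega

lemma homotopy (a b : ℕ) (x : Emod K n a (b+1)) :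
    DD K n (HH K n (io K n a (b+1) x)) + HH K n (DD K n (io K n a (b+1) x)) =
      io K n a (b+1) x := homotopy_gen K n a (b+1) (by omega) x

lemma HH_range (a b : ℕ) (x : Emod K n a (b+1)) :
    ∃ z : Emod K n (a+1) b, io K n (a+1) b z = HH K n (io K n a (b+1) x) := by
  suffices h : LinearMap.range ((HH K n).comp (io K n a (b+1))) ≤
      LinearMap.range (io K n (a+1) b) from h ⟨x, rfl⟩
  rintro _ ⟨x, rfl⟩
  induction x using Finsupp.induction_linear with
  | zero => simp
  | add f g hf hg => rw [map_add]; exact add_mem hf hg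
  | single p r =>
    have : Finsupp.single p r = r • Finsupp.single p (1 : Rp K n) := by simp
    rw [this, map_smul]
    apply Submodule.smul_mem
    rw [LinearMap.comp_apply, io_single, HH_single]
    by_cases h : ∃ i, PP n i (jj n a (b+1) p)
    · obtain ⟨i, hi⟩ := h
      rw [Hb_of K n hi]
      have h1 : i ∉ p.1.1 := fun h => lt_irrefl _ (hi.2.1 i h)
      refine ⟨Finsupp.single (⟨insert i p.1.1, by
        rw [Finset.card_insert_of_notMem h1, p.1.2]⟩,
        ⟨(p.2 : Multiset (Fin n)).erase i, by
          have h2 : i ∈ (p.2 : Multiset (Fin n)) := hi.1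
          rw [Multiset.card_erase_of_mem h2]; simp⟩) 1, ?_⟩
      rw [io_single]
      rfl
    · rw [Hb_not K n h]; exact zero_mem _

lemma HH_apply_B (X : GG K n) (q : QQ n) (hq : ∃ i, PP n i q) : HH K n X q = 0 := by
  induction X using Finsupp.induction_linear with
  | zero => simp
  | add f g hf hg => rw [map_add, Finsupp.add_apply, hf, hg, add_zero]
  | single p r =>
    have : Finsupp.single p r = r • Finsupp.single p (1 : Rp K n) := by simp
    rw [this, map_smul, HH_single, Finsupp.smul_apply]
    by_cases h : ∃ i, PP n i p
    · obtain ⟨i, hi⟩ := h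
      rw [Hb_of K n hi, Finsupp.single_eq_of_ne, smul_zero]
      rintro rfl
      obtain ⟨k, hk1, hk2, -⟩ := hq
      have h1 : k < i := hk2 i (by simp)
      exact absurd (hi.2.2 k (Multiset.mem_of_mem_erase hk1)) (not_le.2 h1)
    · rw [Hb_not K n h]; simp

lemma HH_zero_of_B (a b : ℕ) (x : Emod K n a b)
    (hx : ∀ p, (∃ i, PP n i (jj n a b p)) → x p = 0) : HH K n (io K n a b x) = 0 := by
  rw [← Finsupp.sum_single x, Finsupp.sum, map_sum, map_sum]
  apply Finset.sum_eq_zero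
  intro p _
  have : Finsupp.single p (x p) = x p • Finsupp.single p (1 : Rp K n) := by simp
  rw [this, map_smul, map_smul, io_single, HH_single]
  by_cases h : ∃ i, PP n i (jj n a b p)
  · rw [hx p h, zero_smul]
  · rw [Hb_not K n h, smul_zero]

def BB (a b : ℕ) : Type := {p : EB n a b // ∃ i, PP n i (jj n a b p)}

def resB (a b : ℕ) : Lmod K n a b →ₗ[Rp K n] (BB n a b →₀ Rp K n) :=
  (Finsupp.lcomapDomain (fun p : BB n a b => p.1) Subtype.val_injective).comp
    (Lmod K n a b).subtype

lemma resB_apply (a b : ℕ) (x : Lmod K n a b) (p : BB n a b) : resB K n a b x p = x.1 p.1 := rfl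

lemma kappa_mem (a b : ℕ) (z : Emod K n (a+1) b) :
    kappa K n (a+1) b z ∈ Lmod K n a (b+1) := by
  rw [mem_Lmod]
  have := io_kappa K n (a+1) b z
  change io K n a (b+1) _ = _ at this
  erw [this, DD_DD]

lemma resB_bij (a b : ℕ) : Function.Bijective (resB K n a (b+1)) := by
  constructor
  · intro x x' hx
    have hw : x.1 - x'.1 ∈ Lmod K n a (b+1) := sub_mem x.2 x'.2
    have h1 : HH K n (io K n a (b+1) (x.1 - x'.1)) = 0 := by
      apply HH_zero_of_B
      intro p hp
      have h3 : x.1 p = x'.1 p := DFunLike.congr_fun hx (⟨p, hp⟩ : BB n a (b+1))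
      rw [Finsupp.sub_apply, h3, sub_self]
    have h2 := homotopy K n a b (x.1 - x'.1)
    rw [h1, (mem_Lmod K n a (b+1) _).1 hw, map_zero, map_zero, add_zero] at h2
    apply Subtype.ext
    apply sub_eq_zero.1
    exact io_inj K n _ _ (by rw [← h2, map_zero])
  · intro y
    let y' : Emod K n a (b+1) := Finsupp.mapDomain (fun p : BB n a (b+1) => p.1) y
    have hy : ∀ p : BB n a (b+1), y' p.1 = y p := fun p =>
      Finsupp.mapDomain_apply Subtype.val_injective y p
    obtain ⟨z, hz⟩ := HH_range K n a b y'
    refine ⟨⟨kappa K n (a+1) b z, kappa_mem K n a b z⟩, ?_⟩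
    ext1 p
    rw [resB_apply, ← hy, ← io_apply, ← io_apply K n a (b+1) y']
    have h1 := io_kappa K n (a+1) b z
    change io K n a (b+1) _ = _ at h1
    have h2 := homotopy K n a b y'
    rw [← hz, ← h1] at h2
    rw [← h2, Finsupp.add_apply, HH_apply_B K n _ _ p.2, add_zero]

lemma Lmod_free (a b : ℕ) : Module.Free (Rp K n) (Lmod K n a (b+1)) :=
  Module.Free.of_equiv (LinearEquiv.ofBijective _ (resB_bij K n a b)).symm

lemma range_kappa (a b : ℕ) :
    LinearMap.range (kappa K n (a+1) b) = Lmod K n a (b+1) := by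
  apply le_antisymm
  · rintro _ ⟨z, rfl⟩
    exact kappa_mem K n a b z
  · intro x hx
    obtain ⟨z, hz⟩ := HH_range K n a b x
    refine ⟨z, ?_⟩
    apply io_inj K n a (b+1)
    have h1 := io_kappa K n (a+1) b z
    change io K n a (b+1) _ = _ at h1
    have h2 := homotopy K n a b x
    rw [(mem_Lmod K n a (b+1) x).1 hx, map_zero, add_zero, ← hz, ← h1] at h2
    exact h2

lemma finrank_rec (a b : ℕ) :
    Module.finrank (Rp K n) (Lmod K n a (b+1)) + Module.finrank (Rp K n) (Lmod K n (a+1) b) =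
      Nat.choose n (a+1) * Nat.choose (n + b - 1) b := by
  have h := Submodule.finrank_quotient_add_finrank (LinearMap.ker (kappa K n (a+1) b))
  rw [(LinearMap.quotKerEquivRange (kappa K n (a+1) b)).finrank_eq] at h
  have h2 : Module.finrank (Rp K n) (Emod K n (a+1) b) =
      Nat.choose n (a+1) * Nat.choose (n + b - 1) b := by
    rw [Module.finrank_finsupp_self, Fintype.card_prod, Sym.card_sym_eq_choose,
      Fintype.card_finset_len, Fintype.card_fin]
  rw [← h2, ← h]
  congr 1
  exact congrArg (fun N : Submodule (Rp K n) (Emod K n a (b+1)) => Module.finrank (Rp K n) N)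
    (range_kappa K n a b).symm

lemma Lmod_zero (a : ℕ) : Lmod K n (a+1) 0 = ⊥ := by
  rw [eq_bot_iff]
  intro x hx
  rw [mem_Lmod] at hx
  rw [Submodule.mem_bot]
  apply io_inj K n (a+1) 0
  rw [map_zero]
  suffices h : DD K n (HH K n (io K n (a+1) 0 x)) + HH K n (DD K n (io K n (a+1) 0 x)) =
      io K n (a+1) 0 x by
    rw [← h, hx, HH_zero_of_B, map_zero, map_zero, add_zero]
    rintro p ⟨i, hi, -⟩
    have h0 : (jj n (a+1) 0 p).2 = 0 := Multiset.card_eq_zero.1 p.2.2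
    rw [h0] at hi
    simp at hi
  exact homotopy_gen K n (a+1) 0 (by omega) x

lemma choose_id (n a c : ℕ) (hn : 1 ≤ n) :
    Nat.choose (n+c+1) (a+c+2) * Nat.choose (a+c+1) a +
      Nat.choose (n+c) (a+c+2) * Nat.choose (a+c+1) (a+1) =
    Nat.choose n (a+1) * Nat.choose (n+c) (c+1) := by
  obtain ⟨n, rfl⟩ := Nat.exists_eq_add_of_le' hn
  have key : ∀ t, Nat.choose (n+1+c) (t+(c+1)) * Nat.choose (t+(c+1)) t =
      Nat.choose (n+1+c) (c+1) * Nat.choose n t := by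
    intro t
    by_cases h : t ≤ n
    · have := Nat.choose_mul (n := n+1+c) (k := t+(c+1)) (s := c+1) (by omega)
      rw [show n+1+c-(c+1) = n by omega, show t+(c+1)-(c+1) = t by omega] at this
      rw [← this, Nat.choose_symm_add]
    · rw [Nat.choose_eq_zero_of_lt (by omega : n+1+c < t+(c+1)),
        Nat.choose_eq_zero_of_lt (by omega : n < t)]; simp
  have k1 := key a
  have k2 := key (a+1)
  have e1 : Nat.choose (n+1+c+1) (a+c+2) =
    Nat.choose (n+1+c) (a+c+1) + Nat.choose (n+1+c) (a+c+2) := Nat.choose_succ_succ _ _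
  have e2 : Nat.choose (a+c+2) (a+1) = Nat.choose (a+c+1) a + Nat.choose (a+c+1) (a+1) :=
    Nat.choose_succ_succ _ _
  have e3 : Nat.choose (n+1) (a+1) = Nat.choose n a + Nat.choose n (a+1) :=
    Nat.choose_succ_succ _ _
  rw [show a+(c+1) = a+c+1 by ring] at k1
  rw [show a+1+(c+1) = a+c+2 by ring, e2] at k2
  rw [e1, e3]
  linarith

end Helpers

/-- For all `a ≥ 0` and `b ≥ 1` (written `b+1`), the Schur module
`L_b^a(F)` is a free `R`-module of rank `binom(n+b-1, a+b) · binom(a+b-1, a)`. -/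
theorem Lmod_free_of_rank (hn : 1 ≤ n) (a b : ℕ) :
    Module.Free (Rp K n) (Lmod K n a (b+1)) ∧
      Module.finrank (Rp K n) (Lmod K n a (b+1)) =
        Nat.choose (n + (b+1) - 1) (a + (b+1)) * Nat.choose (a + (b+1) - 1) a := by
  refine ⟨Lmod_free K n a b, ?_⟩
  induction b generalizing a with
  | zero =>
    have h := finrank_rec K n a 0
    rw [Lmod_zero, finrank_bot] at h
    simpa using h
  | succ c ih =>
    have h := finrank_rec K n a (c+1)
    rw [ih (a+1)] at h
    have e := choose_id n a c hn
    rw [show n + (c+1) - 1 = n + c by omega, show a + 1 + (c+1) = a+c+2 by omega,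
      show a+c+2-1 = a+c+1 by omega] at h
    rw [show n + (c+1+1) - 1 = n + c + 1 by omega, show a + (c+1+1) = a+c+2 by omega,
      show a+c+2-1 = a+c+1 by omega]
    linarith

end
end

section
/- For integers a ≥ 0 and b ≥ 1, the elements κ_{a+1,b-1}(e_{i_0} ∧ ⋯ ∧ e_{i_a} ⊗ e_{j_1}⋯e_{j_{b-1}}), indexed by all sequences with 1 ≤ i_0 < i_1 < ⋯ < i_a ≤ n and i_0 ≤ j_1 ≤ ⋯ ≤ j_{b-1} ≤ n, form a free R-module basis of L_b^a(F). (These elements are the semistandard hook tableaux with column entries i_0,…,i_a and first-row entries i_0, j_1,…,j_{b-1}.) -/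
open Finset MvPolynomial

noncomputable section

variable (K : Type) [Field K] (n : ℕ)

/-- Index set for the semistandard hook tableaux: a set `{i_0 < i_1 < ⋯ < i_a}` of
column entries together with a multiset `j_1 ≤ ⋯ ≤ j_{b-1}` of row entries such that
`i_0 ≤ j_1`, i.e. every row entry is at least some column entry (equivalently at least
the minimal column entry `i_0`). -/
def StdIdx (a b : ℕ) : Type :=
  {p : EB n (a+1) b // ∀ j ∈ p.2, ∃ i ∈ p.1.1, i ≤ j}

/-- The semistandard hook tableau with column `i_0 < ⋯ < i_a` and first-row entries
`i_0, j_1, …, j_{b-1}`, as the element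
`κ_{a+1,b-1}(e_{i_0} ∧ ⋯ ∧ e_{i_a} ⊗ e_{j_1}⋯e_{j_{b-1}})` of `Λ^a F ⊗ S_b`. -/
def stdTab (a b : ℕ) (p : StdIdx n a b) : Emod K n a (b+1) :=
  kappa K n (a+1) b (Finsupp.single p.1 1)


/-- total version of basis vectors -/
def gvec (a b : ℕ) (s : Finset (Fin n)) (m : Multiset (Fin n)) : Emod K n a b :=
  if h : s.card = a ∧ m.card = b then Finsupp.single (⟨s, h.1⟩, ⟨m, h.2⟩) 1 else 0

theorem single_eq_gvec (a b : ℕ) (p : EB n a b) :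
    (Finsupp.single p 1 : Emod K n a b) = gvec K n a b p.1.1 p.2.1 := by
  rw [gvec, dif_pos ⟨p.1.2, p.2.2⟩]
  rfl

theorem kappa_single (a b : ℕ) (p : EB n a b) :
    kappa K n a b (Finsupp.single p 1) =
      ∑ i ∈ p.1.1, ((-1 : Rp K n) ^ (p.1.1.filter (fun j => j < i)).card) •
        gvec K n (a-1) (b+1) (p.1.1.erase i) (i ::ₘ p.2.1) := by
  rw [← Finset.sum_attach p.1.1]
  simp only [kappa, Finsupp.lift_apply]
  rw [Finsupp.sum_single_index (by simp), one_smul]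
  refine Finset.sum_congr rfl fun i _ => ?_
  rw [single_eq_gvec]
  rfl

theorem kappa_gvec (a b : ℕ) (s : Finset (Fin n)) (m : Multiset (Fin n))
    (hs : s.card = a) (hm : m.card = b) :
    kappa K n a b (gvec K n a b s m) =
      ∑ i ∈ s, ((-1 : Rp K n) ^ (s.filter (fun j => j < i)).card) •
        gvec K n (a-1) (b+1) (s.erase i) (i ::ₘ m) := by
  rw [gvec, dif_pos ⟨hs, hm⟩, kappa_single]

theorem sgn_aux (s : Finset (Fin n)) (i j : Fin n) (hi : i ∈ s) (h : i < j) :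
    (-1 : Rp K n) ^ (s.filter (fun k => k < i)).card *
      (-1 : Rp K n) ^ ((s.erase i).filter (fun k => k < j)).card +
    (-1 : Rp K n) ^ (s.filter (fun k => k < j)).card *
      (-1 : Rp K n) ^ ((s.erase j).filter (fun k => k < i)).card = 0 := by
  have h1 : ((s.erase j).filter (fun k => k < i)) = s.filter (fun k => k < i) := by
    ext k; simp only [mem_filter, mem_erase]
    constructor
    · tauto
    · rintro ⟨h1, h2⟩; exact ⟨⟨(h2.trans h).ne, h1⟩, h2⟩
  have h2 : (s.filter (fun k => k < j)).card
      = ((s.erase i).filter (fun k => k < j)).card + 1 := by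
    rw [Finset.filter_erase, Finset.card_erase_add_one]
    simp [hi, h]
  rw [h1, h2, pow_succ]; ring

theorem kappa_kappa_single (a b : ℕ) (p : EB n (a+1) b) :
    kappa K n a (b+1) (kappa K n (a+1) b (Finsupp.single p 1)) = 0 := by
  rw [kappa_single]
  obtain ⟨⟨s, hs⟩, ⟨m, hm⟩⟩ := p
  simp only [map_sum, map_smul]
  have : ∀ i ∈ s, kappa K n a (b+1) (gvec K n (a+1-1) (b+1) (s.erase i) (i ::ₘ m)) = 
      ∑ j ∈ s.erase i, ((-1 : Rp K n) ^ ((s.erase i).filter (fun k => k < j)).card) •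
        gvec K n (a-1) (b+1+1) ((s.erase i).erase j) (j ::ₘ i ::ₘ m) := by
    intro i hi
    exact kappa_gvec K n a (b+1) _ _ (by rw [card_erase_of_mem hi, hs]; rfl) (by simp [hm])
  rw [Finset.sum_congr rfl fun i hi => by rw [this i hi, Finset.smul_sum], Finset.sum_sigma']
  refine Finset.sum_involution (fun x _ => ⟨x.2, x.1⟩) ?_ ?_ ?_ ?_
  · rintro ⟨i, j⟩ h
    simp only [mem_sigma, mem_erase] at h
    obtain ⟨hi, hji, hj⟩ := h
    simp only [smul_smul]
    rw [Finset.erase_right_comm, Multiset.cons_swap, ← add_smul]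
    rcases lt_or_gt_of_ne hji with h | h
    · rw [(add_comm _ _).trans (sgn_aux K n s j i hj h), zero_smul]
    · rw [sgn_aux K n s i j hi h, zero_smul]
  · rintro ⟨i, j⟩ h _ e
    simp only [mem_sigma, mem_erase] at h
    simp only [Sigma.mk.injEq] at e
    exact h.2.1 e.1
  · rintro ⟨i, j⟩ h
    simp only [mem_sigma, mem_erase] at h ⊢
    exact ⟨h.2.2, Ne.symm h.2.1, h.1⟩
  · rintro ⟨i, j⟩ h
    rfl

theorem stdIdx_nonempty (a b : ℕ) (q : StdIdx n a b) : q.1.1.1.Nonempty := by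
  rw [← Finset.card_pos, q.1.1.2]; omega

/-- minimal column entry -/
def qmin (a b : ℕ) (q : StdIdx n a b) : Fin n := q.1.1.1.min' (stdIdx_nonempty n a b q)

theorem qmin_mem (a b : ℕ) (q : StdIdx n a b) : qmin n a b q ∈ q.1.1.1 := Finset.min'_mem _ _

theorem qmin_le (a b : ℕ) (q : StdIdx n a b) (i) (hi : i ∈ q.1.1.1) : qmin n a b q ≤ i :=
  Finset.min'_le _ _ hi

theorem qmin_le2 (a b : ℕ) (q : StdIdx n a b) (j) (hj : j ∈ q.1.2) : qmin n a b q ≤ j := by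
  obtain ⟨i, hi, h⟩ := q.2 j hj
  exact (qmin_le n a b q i hi).trans h

/-- leading term -/
def lead (a b : ℕ) (q : StdIdx n a b) : EB n a (b+1) :=
  (⟨q.1.1.1.erase (qmin n a b q), by
    rw [Finset.card_erase_of_mem (qmin_mem n a b q), q.1.1.2]; rfl⟩, qmin n a b q ::ₛ q.1.2)

theorem gvec_apply (a b : ℕ) (s : Finset (Fin n)) (m : Multiset (Fin n)) (c : EB n a b) :
    gvec K n a b s m c = if s = c.1.1 ∧ m = c.2.1 then 1 else 0 := by
  obtain ⟨⟨t, ht⟩, ⟨l, hl⟩⟩ := c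
  unfold gvec
  split_ifs with h1 h2 h2
  · obtain ⟨rfl, rfl⟩ := h2
    simp
  · rw [Finsupp.single_apply, if_neg]
    intro e
    exact h2 ⟨congrArg (fun c : EB n a b => c.1.1) e, congrArg (fun c : EB n a b => c.2.1) e⟩
  · obtain ⟨rfl, rfl⟩ := h2
    exact absurd ⟨ht, hl⟩ h1
  · rfl

open Classical in
theorem stdTab_lead (a b : ℕ) (p q : StdIdx n a b) :
    stdTab K n a b p (lead n a b q) = if p = q then 1 else 0 := by
  have key : ∀ i ∈ p.1.1.1, (p.1.1.1.erase i = q.1.1.1.erase (qmin n a b q) ∧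
      i ::ₘ p.1.2.1 = qmin n a b q ::ₘ q.1.2.1) → i = qmin n a b p ∧ p = q := by
    rintro i hi ⟨h1, h2⟩
    have hle : qmin n a b q ≤ qmin n a b p := by
      by_cases e : qmin n a b p = i
      · have : i ∈ qmin n a b q ::ₘ q.1.2.1 := h2 ▸ Multiset.mem_cons_self _ _
        rw [e]
        rcases Multiset.mem_cons.1 this with h | h
        · exact h.ge
        · exact qmin_le2 n a b q i h
      · have : qmin n a b p ∈ q.1.1.1.erase (qmin n a b q) := by
          rw [← h1]; exact mem_erase.2 ⟨e, qmin_mem n a b p⟩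
        exact qmin_le n a b q _ (mem_erase.1 this).2
    have hge : qmin n a b p ≤ qmin n a b q := by
      have : qmin n a b q ∈ i ::ₘ p.1.2.1 := h2 ▸ Multiset.mem_cons_self _ _
      rcases Multiset.mem_cons.1 this with h | h
      · rw [h]; exact qmin_le n a b p i hi
      · exact qmin_le2 n a b p _ h
    have heq := le_antisymm hle hge
    have hi' : i = qmin n a b p := by
      by_contra hne
      have : qmin n a b p ∈ q.1.1.1.erase (qmin n a b q) := by
          rw [← h1]; exact mem_erase.2 ⟨Ne.symm hne, qmin_mem n a b p⟩
      exact (mem_erase.1 this).1 heq.symm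
    refine ⟨hi', ?_⟩
    rw [hi', heq] at h2
    rw [hi'] at h1
    have e1 : p.1.1.1 = q.1.1.1 := by
      rw [← insert_erase (qmin_mem n a b p), h1, ← heq, insert_erase (qmin_mem n a b q)]
    apply Subtype.ext
    apply Prod.ext
    · exact Subtype.ext e1
    · exact Subtype.ext (Multiset.cons_inj_right _ |>.1 (by rw [← heq] at h2; exact h2))
  unfold stdTab
  rw [kappa_single, Finsupp.finsetSum_apply]
  simp only [Finsupp.smul_apply, smul_eq_mul]
  rw [Finset.sum_eq_single (qmin n a b p)]
  · have : (p.1.1.1.filter (fun j => j < qmin n a b p)) = ∅ := by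
      apply Finset.filter_eq_empty_iff.2
      intro j hj
      exact not_lt.2 (qmin_le n a b p j hj)
    rw [this]
    simp only [card_empty, pow_zero, one_mul]
    refine (gvec_apply K n a (b+1) _ _ _).trans ?_
    by_cases e : p = q
    · subst e
      rw [if_pos rfl, if_pos ⟨rfl, rfl⟩]
    · rw [if_neg e]
      exact if_neg fun h => e (key _ (qmin_mem n a b p) h).2
  · intro i hi hne
    refine mul_eq_zero_of_right _ ?_
    refine (gvec_apply K n a (b+1) _ _ _).trans ?_
    exact if_neg fun h => hne (key _ hi h).1
  · intro h; exact absurd (qmin_mem n a b p) h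

theorem exists_lead (a b : ℕ) (c : EB n a (b+1)) (hc : ¬ ∀ j ∈ c.2, ∃ i ∈ c.1.1, i ≤ j) :
    ∃ q, lead n a b q = c := by
  push Not at hc
  obtain ⟨⟨s, hs⟩, m⟩ := c
  obtain ⟨j0, hj0, h0⟩ := hc
  simp only at hj0 h0
  have hne : m.1.toFinset.Nonempty := ⟨j0, by simpa using hj0⟩
  obtain ⟨j, hj, hmin⟩ := Finset.exists_min_image m.1.toFinset id hne
  have hjm : j ∈ m := by simpa using hj
  have hmin' : ∀ k ∈ m, j ≤ k := fun k hk => hmin k (by simpa using hk)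
  have hjs : ∀ i ∈ s, j < i := fun i hi => (hmin' j0 hj0).trans_lt (h0 i hi)
  have hjn : j ∉ s := fun h => lt_irrefl _ (hjs j h)
  let q : StdIdx n a b := ⟨(⟨insert j s, by rw [card_insert_of_notMem hjn, hs]⟩, m.erase j hjm), by
    intro k hk
    refine ⟨j, mem_insert_self _ _, hmin' k ?_⟩
    exact Multiset.mem_of_mem_erase hk⟩
  have hq : qmin n a b q = j := by
    apply le_antisymm
    · exact qmin_le n a b q j (mem_insert_self _ _)
    · rcases mem_insert.1 (qmin_mem n a b q) with h | h
      · exact h.ge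
      · exact (hjs _ h).le
  refine ⟨q, ?_⟩
  apply Prod.ext
  · apply Subtype.ext
    change (insert j s).erase (qmin n a b q) = s
    rw [hq, erase_insert hjn]
  · change qmin n a b q ::ₛ m.erase j hjm = m
    rw [hq, Sym.cons_erase]

instance (a b : ℕ) : Finite (StdIdx n a b) := by unfold StdIdx; infer_instance

theorem tab_coord (a b : ℕ) (l : StdIdx n a b →₀ Rp K n) (q : StdIdx n a b) :
    (Finsupp.linearCombination (Rp K n) (stdTab K n a b) l) (lead n a b q) = l q := by
  classical
  rw [Finsupp.linearCombination_apply, Finsupp.sum, Finsupp.finsetSum_apply]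
  simp only [Finsupp.smul_apply, stdTab_lead, smul_eq_mul, mul_ite, mul_one, mul_zero]
  simp
  exact Eq.symm

theorem std_li (a b : ℕ) : LinearIndependent (Rp K n) (stdTab K n a b) := by
  rw [linearIndependent_iff]
  intro l hl
  ext1 q
  rw [← tab_coord, hl]; rfl

theorem ker_zero (a b : ℕ) (y : Emod K n a (b+1)) (hy : kappa K n a (b+1) y = 0)
    (h0 : ∀ q, y (lead n a b q) = 0) : y = 0 := by
  have hB : ∀ c, y c ≠ 0 → ∀ j ∈ c.2, ∃ i ∈ c.1.1, i ≤ j := by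
    intro c hc
    by_contra h
    obtain ⟨q, rfl⟩ := exists_lead n a b c h
    exact hc (h0 q)
  rcases a with _ | a
  · ext1 c
    by_contra hc
    obtain ⟨j, hj⟩ := c.2.exists_mem
    obtain ⟨i, hi, _⟩ := hB c hc j hj
    rw [Finset.card_eq_zero.1 c.1.2] at hi
    simp at hi
  · have inj : Function.Injective (fun q : StdIdx n a (b+1) => q.1) := Subtype.val_injective
    let l : StdIdx n a (b+1) →₀ Rp K n := y.comapDomain (fun q => q.1) inj.injOn
    have hl : l.mapDomain (fun q => q.1) = y := by
      apply Finsupp.mapDomain_comapDomain _ inj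
      intro c hc
      exact ⟨⟨c, hB c (Finsupp.mem_support_iff.1 hc)⟩, rfl⟩
    have : Finsupp.linearCombination (Rp K n) (stdTab K n a (b+1)) l = 0 := by
      have e : stdTab K n a (b+1) = fun q => kappa K n (a+1) (b+1) (Finsupp.single q.1 1) := rfl
      rw [e, ← hy, ← hl, Finsupp.mapDomain, Finsupp.sum, map_sum, Finsupp.linearCombination_apply,
        Finsupp.sum]
      refine Finset.sum_congr rfl fun q _ => ?_
      rw [← map_smul, Finsupp.smul_single, smul_eq_mul, mul_one]
    have := linearIndependent_iff.1 (std_li K n a (b+1)) l this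
    rw [← hl, this, Finsupp.mapDomain_zero]

/-- For `a ≥ 0`, `b ≥ 1` (written `b+1`), the elements
`κ_{a+1,b-1}(e_{i_0} ∧ ⋯ ∧ e_{i_a} ⊗ e_{j_1}⋯e_{j_{b-1}})` indexed by
`1 ≤ i_0 < ⋯ < i_a ≤ n`, `i_0 ≤ j_1 ≤ ⋯ ≤ j_{b-1} ≤ n` are linearly independent and
span exactly the Schur module `L_b^a(F) = ker κ_{a,b}`; i.e. they form a free module
basis of `L_b^a(F)`. -/
theorem stdTab_basis (hn : 1 ≤ n) (a b : ℕ) :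
    LinearIndependent (Rp K n) (stdTab K n a b) ∧
      Submodule.span (Rp K n) (Set.range (stdTab K n a b)) =
        LinearMap.ker (kappa K n a (b+1)) := by
  refine ⟨std_li K n a b, le_antisymm ?_ ?_⟩
  · rw [Submodule.span_le]
    rintro _ ⟨q, rfl⟩
    exact kappa_kappa_single K n a b q.1
  · intro x hx
    let l : StdIdx n a b →₀ Rp K n := Finsupp.equivFunOnFinite.symm fun q => x (lead n a b q)
    have hmem : Finsupp.linearCombination (Rp K n) (stdTab K n a b) l ∈
        Submodule.span (Rp K n) (Set.range (stdTab K n a b)) := by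
      rw [Finsupp.mem_span_range_iff_exists_finsupp]
      exact ⟨l, rfl⟩
    have hk : kappa K n a (b+1) (Finsupp.linearCombination (Rp K n) (stdTab K n a b) l) = 0 := by
      rw [Finsupp.linearCombination_apply, Finsupp.sum, map_sum]
      refine Finset.sum_eq_zero fun q _ => ?_
      rw [map_smul, stdTab]
      erw [kappa_kappa_single K n a b q.1]
      rw [smul_zero]
    have : x - Finsupp.linearCombination (Rp K n) (stdTab K n a b) l = 0 := by
      apply ker_zero
      · rw [map_sub, hk, LinearMap.mem_ker.1 hx, sub_zero]
      · intro q
        rw [Finsupp.sub_apply, tab_coord]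
        exact sub_self _
    rw [sub_eq_zero.1 this]
    exact hmem

end
end

section
/- Let I ⊆ R = k[x_1,…,x_n] be a Borel-fixed monomial ideal. Then the Eliahou–Kervaire complex F_I, with differential d = ∂ − μ, is a minimal free resolution of R/I. -/
open Finset MvPolynomial

attribute [local instance] Classical.propDecidable

noncomputable section

variable (K : Type) [Field K] (n : ℕ)

/-!  Monomials are represented by their exponent vectors `α : Fin n →₀ ℕ`
(the monomial `x^α`); multiplication of monomials is addition of exponent vectors,
and divisibility is pointwise `≤`. -/

/-- A set of monomials (exponent vectors) is a monomial ideal if it is closed under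
multiplication by arbitrary monomials. -/
def MonomialIdeal (M : Set (Fin n →₀ ℕ)) : Prop :=
  ∀ a ∈ M, ∀ b : Fin n →₀ ℕ, a + b ∈ M

/-- A monomial ideal is Borel-fixed if for every monomial `g` and indices `i < j`,
`g x_j ∈ I` implies `g x_i ∈ I`. -/
def BorelFixed (M : Set (Fin n →₀ ℕ)) : Prop :=
  ∀ (g : Fin n →₀ ℕ) (i j : Fin n), i < j →
    g + Finsupp.single j 1 ∈ M → g + Finsupp.single i 1 ∈ M

/-- `u` is a minimal monomial generator of the monomial ideal `M`. -/
def IsMinGen (M : Set (Fin n →₀ ℕ)) (u : Fin n →₀ ℕ) : Prop :=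
  u ∈ M ∧ ∀ v ∈ M, v ≤ u → v = u

/-- `u` is the beginning of `g`: `u` is a minimal generator, `u` divides `g` (say
`g = u·v`) and `max(u) ≤ min(v)` (interpreted so that the condition is vacuous when
`u = 1` or `v = 1`, matching the conventions `max(1) = 0`, `min(1) = +∞`). -/
def IsBeginning (M : Set (Fin n →₀ ℕ)) (g u : Fin n →₀ ℕ) : Prop :=
  IsMinGen n M u ∧ ∃ v : Fin n →₀ ℕ, g = u + v ∧
    ∀ i ∈ u.support, ∀ j ∈ v.support, i ≤ j

/-- The beginning `b(g)` of a monomial `g ∈ M` (defined by choice; in a Borel-fixed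
monomial ideal it exists and is unique). -/
def bFun (M : Set (Fin n →₀ ℕ)) (g : Fin n →₀ ℕ) : Fin n →₀ ℕ :=
  if h : ∃ u, IsBeginning n M g u then h.choose else g

/-- The basis index set for `(F_I)_{k+1}`: Eliahou–Kervaire symbols
`(m_p; j_1, …, j_k)` with `m_p` a minimal generator and `j_1 < ⋯ < j_k < max(m_p)`. -/
def FIdx (M : Set (Fin n →₀ ℕ)) (k : ℕ) : Type :=
  {p : (Fin n →₀ ℕ) × Finset (Fin n) //
    IsMinGen n M p.1 ∧ p.2.card = k ∧ ∀ j ∈ p.2, ∃ t ∈ p.1.support, j < t}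

/-- The terms of the Eliahou–Kervaire resolution: `(F_I)_0 = R` and `(F_I)_{k+1}` free
on the symbols above. -/
def FImod (M : Set (Fin n →₀ ℕ)) : ℕ → Type
  | 0 => Rp K n
  | k+1 => FIdx n M k →₀ Rp K n

instance (M : Set (Fin n →₀ ℕ)) : (k : ℕ) → AddCommGroup (FImod K n M k)
  | 0 => inferInstanceAs (AddCommGroup (Rp K n))
  | k+1 => inferInstanceAs (AddCommGroup (FIdx n M k →₀ Rp K n))

instance (M : Set (Fin n →₀ ℕ)) : (k : ℕ) → Module (Rp K n) (FImod K n M k)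
  | 0 => inferInstanceAs (Module (Rp K n) (Rp K n))
  | k+1 => inferInstanceAs (Module (Rp K n) (FIdx n M k →₀ Rp K n))

/-- The Eliahou–Kervaire symbol `(u; s)` as a basis element of `(F_I)_{k+1}` if legal,
and `0` otherwise (the standard convention). -/
def fOf (M : Set (Fin n →₀ ℕ)) (k : ℕ) (u : Fin n →₀ ℕ) (s : Finset (Fin n)) :
    FIdx n M k →₀ Rp K n :=
  if h : IsMinGen n M u ∧ s.card = k ∧ ∀ j ∈ s, ∃ t ∈ u.support, j < t then
    Finsupp.single ⟨(u, s), h⟩ 1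
  else 0

/-- The Eliahou–Kervaire differential `d = ∂ - μ`; the augmentation
`(F_I)_1 → R` sends `(m_p)` to the monomial `m_p`. -/
def dFI (M : Set (Fin n →₀ ℕ)) : (k : ℕ) → FImod K n M (k+1) →ₗ[Rp K n] FImod K n M k
  | 0 => Finsupp.lift _ _ _ fun p => monomial p.1.1 (1 : K)
  | k+1 => Finsupp.lift _ _ _ fun p =>
      -- ∂(m_p; j_1, …, j_i) = Σ_q (-1)^q x_{j_q} (m_p; j_1, …, ĵ_q, …, j_i)
      (∑ j ∈ p.1.2.attach,
        (((-1 : Rp K n) ^ ((p.1.2.filter (fun t => t < j.1)).card + 1)) * X j.1) •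
          fOf K n M k p.1.1 (p.1.2.erase j.1))
      -- μ(m_p; j_1, …, j_i) = Σ_q (-1)^q (m_p x_{j_q}/b(m_p x_{j_q}))
      --                                   (b(m_p x_{j_q}); j_1, …, ĵ_q, …, j_i)
      - (∑ j ∈ p.1.2.attach,
        (((-1 : Rp K n) ^ ((p.1.2.filter (fun t => t < j.1)).card + 1)) *
            monomial ((p.1.1 + Finsupp.single j.1 1) -
              bFun n M (p.1.1 + Finsupp.single j.1 1)) (1 : K)) •
          fOf K n M k (bFun n M (p.1.1 + Finsupp.single j.1 1)) (p.1.2.erase j.1))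

section EKaux

set_option linter.unusedSimpArgs false

variable {n} {M : Set (Fin n →₀ ℕ)}

theorem ek_exists_beg (hMI : MonomialIdeal n M) (hB : BorelFixed n M) :
    ∀ (N : ℕ) (g : Fin n →₀ ℕ), g.degree = N → g ∈ M → ∃ u, IsBeginning n M g u := by
  intro N
  induction N with
  | zero =>
    intro g hg hgM
    have h0 : g = 0 := by simpa [Finsupp.degree_eq_zero_iff] using hg
    refine ⟨g, ⟨hgM, fun v hv hvg => ?_⟩, 0, by simp, by simp⟩
    subst h0
    exact le_antisymm hvg (zero_le)
  | succ N ih =>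
    intro g hg hgM
    by_cases hmin : IsMinGen n M g
    · exact ⟨g, hmin, 0, by simp, by simp⟩
    have : ∃ v ∈ M, v ≤ g ∧ v ≠ g := by
      by_contra hcon
      push Not at hcon
      exact hmin ⟨hgM, hcon⟩
    obtain ⟨v, hv, hvg, hne⟩ := this
    have : ∃ i, v i < g i := by
      by_contra hcon
      push Not at hcon
      exact hne (le_antisymm hvg hcon)
    obtain ⟨i, hi⟩ := this
    have hgi : g i ≠ 0 := by omega
    have hsup : g.support.Nonempty := ⟨i, by simpa using hgi⟩
    obtain ⟨t, htm, htmax⟩ : ∃ t ∈ g.support, ∀ r ∈ g.support, r ≤ t :=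
      ⟨g.support.max' hsup, Finset.max'_mem _ _, fun r hr => Finset.le_max' _ _ hr⟩
    have hgt : g t ≠ 0 := by simpa using htm
    have hit : i ≤ t := htmax i (by simpa using hgi)
    have h1 : g - Finsupp.single i 1 ∈ M := by
      have : g - Finsupp.single i 1 = v + ((g - Finsupp.single i 1) - v) := by
        ext r
        have := hvg r
        by_cases hr : i = r
        · subst hr; simp; omega
        · simp [Finsupp.single_apply, hr]; omega
      rw [this]
      exact hMI _ hv _
    have h2 : g - Finsupp.single t 1 ∈ M := by
      rcases hit.eq_or_lt with h | h
      · rwa [← h]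
      have := hB (g - Finsupp.single i 1 - Finsupp.single t 1) i t h (by
        convert h1 using 1
        ext r
        by_cases hr : t = r
        · subst hr; simp [Finsupp.single_apply, h.ne]; omega
        · simp [Finsupp.single_apply, hr])
      convert this using 1
      ext r
      by_cases hr : i = r
      · subst hr; simp [Finsupp.single_apply, h.ne']; omega
      · simp [Finsupp.single_apply, hr]
    have hdec : g = (g - Finsupp.single t 1) + Finsupp.single t 1 := by
      ext r
      by_cases hr : t = r
      · subst hr; simp; omega
      · simp [Finsupp.single_apply, hr]
    have hdeg : (g - Finsupp.single t 1).degree = N := by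
      have := congrArg Finsupp.degree hdec
      rw [hg, map_add] at this
      simp at this
      omega
    obtain ⟨u, hu, w, hw, hlt⟩ := ih _ hdeg h2
    refine ⟨u, hu, w + Finsupp.single t 1, ?_, ?_⟩
    · rw [← add_assoc, ← hw]; exact hdec
    · intro a ha b hb
      have hb' : w b + (Finsupp.single t 1 : Fin n →₀ ℕ) b ≠ 0 := by simpa using hb
      by_cases hr : t = b
      · subst hr
        apply htmax
        have : u a ≠ 0 := by simpa using ha
        rw [hdec, hw]
        simp
        omega
      · apply hlt a ha b
        simpa [Finsupp.single_apply, hr] using hb'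

theorem ek_beg_unique {g u u' : Fin n →₀ ℕ} (h : IsBeginning n M g u)
    (h' : IsBeginning n M g u') : u = u' := by
  obtain ⟨hu, v, hv, hl⟩ := h
  obtain ⟨hu', v', hv', hl'⟩ := h'
  by_cases h1 : u ≤ u'
  · exact hu'.2 _ hu.1 h1
  by_cases h2 : u' ≤ u
  · exact (hu.2 _ hu'.1 h2).symm
  exfalso
  rw [Finsupp.le_def] at h1 h2
  push Not at h1 h2
  obtain ⟨i, hi⟩ := h1
  obtain ⟨j, hj⟩ := h2
  have e : ∀ r, u r + v r = u' r + v' r := fun r => by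
    have := DFunLike.congr_fun (hv.symm.trans hv') r
    simpa using this
  have ei := e i
  have ej := e j
  have a1 := hl i (by simp; omega) j (by simp; omega)
  have a2 := hl' j (by simp; omega) i (by simp; omega)
  have : i = j := le_antisymm a1 a2
  subst this
  omega

theorem ek_b_spec (hMI : MonomialIdeal n M) (hB : BorelFixed n M) {g : Fin n →₀ ℕ}
    (hg : g ∈ M) : IsBeginning n M g (bFun n M g) := by
  have h := ek_exists_beg hMI hB _ g rfl hg
  rw [bFun, dif_pos h]
  exact h.choose_spec

theorem ek_b_eq {g u : Fin n →₀ ℕ} (h : IsBeginning n M g u) : bFun n M g = u := by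
  have h' : ∃ u, IsBeginning n M g u := ⟨u, h⟩
  rw [bFun, dif_pos h']
  exact ek_beg_unique h'.choose_spec h

theorem ek_b_le {g u : Fin n →₀ ℕ} (h : IsBeginning n M g u) : u ≤ g := by
  obtain ⟨_, v, rfl, _⟩ := h
  exact le_self_add

/-- `b(b(g) x_i) = b(g x_i)`. -/
theorem ek_b_b (hMI : MonomialIdeal n M) (hB : BorelFixed n M) {g : Fin n →₀ ℕ}
    (hg : g ∈ M) (i : Fin n) :
    bFun n M (bFun n M g + Finsupp.single i 1) = bFun n M (g + Finsupp.single i 1) := by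
  obtain ⟨hu, v, hv, hl⟩ := ek_b_spec hMI hB hg
  set u := bFun n M g
  obtain ⟨hu', v', hv', hl'⟩ := ek_b_spec hMI hB (hMI _ hu.1 (Finsupp.single i 1))
  set u' := bFun n M (u + Finsupp.single i 1) with hu'def
  symm
  apply ek_b_eq
  refine ⟨hu', v' + v, ?_, ?_⟩
  · rw [← add_assoc, ← hv', hv]; abel
  intro a ha b hb
  have hb' : v' b + v b ≠ 0 := by simpa using hb
  by_cases hb1 : v' b = 0
  swap
  · exact hl' a ha b (by simpa using hb1)
  have hb2 : b ∈ v.support := by simp; omega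
  have e : ∀ r, u r + (Finsupp.single i 1 : Fin n →₀ ℕ) r = u' r + v' r := fun r => by
    have := DFunLike.congr_fun hv' r
    simpa using this
  by_cases hau : u a = 0
  swap
  · exact hl a (by simpa using hau) b hb2
  have ha' : u' a ≠ 0 := by simpa using ha
  have hai : i = a := by
    by_contra hr
    have := e a
    simp [Finsupp.single_apply, hr] at this
    omega
  subst hai
  by_cases hall : ∀ r ∈ u.support, r ≤ i
  · exfalso
    have : u' = u := by
      rw [hu'def]
      apply ek_b_eq
      refine ⟨hu, _, rfl, ?_⟩
      intro r hr j hj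
      have hj' : i = j := by
        by_contra hne
        simp at hj; exact hne hj.symm
      subst hj'
      exact hall r hr
    rw [this] at ha'
    exact ha' hau
  · push Not at hall
    obtain ⟨r, hr, hir⟩ := hall
    exact hir.le.trans (hl r hr b hb2)

theorem ek_b_self {u : Fin n →₀ ℕ} (hu : IsMinGen n M u) (j : Fin n)
    (h : ∀ r ∈ u.support, r ≤ j) : bFun n M (u + Finsupp.single j 1) = u := by
  apply ek_b_eq
  refine ⟨hu, _, rfl, ?_⟩
  intro r hr l hl
  have hj' : j = l := by
    by_contra hne
    simp at hl; exact hne hl.symm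
  subst hj'
  exact h r hr

/-- weight -/
def ekW (u : Fin n →₀ ℕ) : ℕ := ∑ i, (i.1 + 1) * u i

theorem ekW_add (u v : Fin n →₀ ℕ) : ekW (u + v) = ekW u + ekW v := by
  simp [ekW, mul_add, Finset.sum_add_distrib]

theorem ekW_single (j : Fin n) : ekW (Finsupp.single j 1) = j.1 + 1 := by
  simp [ekW, Finsupp.single_apply]

theorem ekW_lower (v : Fin n →₀ ℕ) (l : Fin n) (h : v l ≠ 0) : l.1 + 1 ≤ ekW v := by
  have := Finset.single_le_sum (f := fun i : Fin n => (i.1 + 1) * v i) (s := Finset.univ)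
    (fun _ _ => Nat.zero_le _) (Finset.mem_univ l)
  refine le_trans ?_ this
  exact Nat.le_mul_of_pos_right _ (Nat.pos_of_ne_zero h)

theorem ekW_lt (hMI : MonomialIdeal n M) (hB : BorelFixed n M) {u : Fin n →₀ ℕ}
    (hu : IsMinGen n M u) {j : Fin n} (hj : ∃ t ∈ u.support, j < t) :
    ekW (bFun n M (u + Finsupp.single j 1)) < ekW u := by
  obtain ⟨hu', v, hv, hl⟩ := ek_b_spec hMI hB (hMI _ hu.1 (Finsupp.single j 1))
  set u' := bFun n M (u + Finsupp.single j 1) with hu'def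
  obtain ⟨t, ht, hjt⟩ := hj
  have e : ∀ r, u r + (Finsupp.single j 1 : Fin n →₀ ℕ) r = u' r + v r := fun r => by
    have := DFunLike.congr_fun hv r
    simpa using this
  have hne : u' ≠ u := by
    intro h
    rw [h] at hv hl
    have hv2 : v = Finsupp.single j 1 := (add_left_cancel hv).symm
    have := hl t ht j (by simp [hv2])
    exact absurd this (not_le.mpr hjt)
  have h1 : ¬ u' ≤ u := fun h => hne (hu.2 _ hu'.1 h)
  have h2 : ¬ u ≤ u' := fun h => hne (hu'.2 _ hu.1 h).symm
  rw [Finsupp.le_def] at h1 h2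
  push Not at h1 h2
  obtain ⟨i, hi⟩ := h1
  obtain ⟨l, hll⟩ := h2
  have hji : j = i := by
    by_contra hr
    have := e i
    simp [Finsupp.single_apply, hr] at this
    omega
  subst hji
  have hlj : l ≠ j := by rintro rfl; omega
  have hvl : v l ≠ 0 := by have := e l; omega
  have hjl : j ≤ l := hl j (by simp; omega) l (by simpa using hvl)
  have hjl' : j.1 < l.1 := Fin.lt_def.mp (lt_of_le_of_ne hjl (Ne.symm hlj))
  have h3 := congrArg ekW hv
  rw [ekW_add, ekW_add, ekW_single] at h3
  have := ekW_lower v l hvl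
  omega

end EKaux

section EKcx

variable {n} {M : Set (Fin n →₀ ℕ)}

/-- sign -/
def ekSg (s : Finset (Fin n)) (j : Fin n) : Rp K n :=
  (-1 : Rp K n) ^ ((s.filter (fun t => t < j)).card + 1)

theorem ekSg_swap_aux {s : Finset (Fin n)} {i j : Fin n} (hi : i ∈ s)
    (hij : i < j) :
    ekSg K s j * ekSg K (s.erase j) i = - (ekSg K s i * ekSg K (s.erase i) j) := by
  have h1 : (s.erase j).filter (fun t => t < i) = s.filter (fun t => t < i) := by
    ext r
    simp only [Finset.mem_filter, Finset.mem_erase]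
    constructor
    · rintro ⟨⟨_, a⟩, b⟩; exact ⟨a, b⟩
    · rintro ⟨a, b⟩; exact ⟨⟨(b.trans hij).ne, a⟩, b⟩
  have h2 : (s.filter (fun t => t < j)).card
      = ((s.erase i).filter (fun t => t < j)).card + 1 := by
    have : (s.erase i).filter (fun t => t < j) = (s.filter (fun t => t < j)).erase i := by
      ext r
      simp only [Finset.mem_filter, Finset.mem_erase]
      tauto
    rw [this, Finset.card_erase_add_one]
    simp [hi, hij]
  unfold ekSg
  rw [h1, h2]
  ring

theorem ekSg_swap {s : Finset (Fin n)} {i j : Fin n} (hi : i ∈ s) (hj : j ∈ s)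
    (hij : i ≠ j) :
    ekSg K s j * ekSg K (s.erase j) i = - (ekSg K s i * ekSg K (s.erase i) j) := by
  rcases lt_or_gt_of_ne hij with h | h
  · exact ekSg_swap_aux K hi h
  · rw [ekSg_swap_aux K hj h, neg_neg]

variable (M)

/-- cofactor `u x_j / b(u x_j)` -/
def ekw (u : Fin n →₀ ℕ) (j : Fin n) : Fin n →₀ ℕ :=
  (u + Finsupp.single j 1) - bFun n M (u + Finsupp.single j 1)

/-- formula for the differential -/
def ekT (k : ℕ) (u : Fin n →₀ ℕ) (s : Finset (Fin n)) : FIdx n M k →₀ Rp K n :=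
  ∑ j ∈ s, ekSg K s j • ((X j : Rp K n) • fOf K n M k u (s.erase j)
    - (monomial (ekw M u j) (1 : K) : Rp K n) •
      fOf K n M k (bFun n M (u + Finsupp.single j 1)) (s.erase j))

/-- concrete version of the differential -/
def ekD (k : ℕ) : (FIdx n M (k+1) →₀ Rp K n) →ₗ[Rp K n] (FIdx n M k →₀ Rp K n) :=
  Finsupp.lift _ _ _ fun p => ekT K M k p.1.1 p.1.2

/-- concrete version of the augmentation -/
def ekD0 : (FIdx n M 0 →₀ Rp K n) →ₗ[Rp K n] Rp K n :=
  Finsupp.lift _ _ _ fun p => monomial p.1.1 (1 : K)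

theorem ek_dFI_zero : dFI K n M 0 = ekD0 K M := rfl

theorem ek_T_attach (k : ℕ) (u : Fin n →₀ ℕ) (s : Finset (Fin n)) :
    (∑ j ∈ s.attach,
        (((-1 : Rp K n) ^ ((s.filter (fun t => t < j.1)).card + 1)) * X j.1) •
          fOf K n M k u (s.erase j.1))
      - (∑ j ∈ s.attach,
        (((-1 : Rp K n) ^ ((s.filter (fun t => t < j.1)).card + 1)) *
            monomial ((u + Finsupp.single j.1 1) -
              bFun n M (u + Finsupp.single j.1 1)) (1 : K)) •
          fOf K n M k (bFun n M (u + Finsupp.single j.1 1)) (s.erase j.1)) = ekT K M k u s := by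
  rw [Finset.sum_attach s (fun j =>
        (((-1 : Rp K n) ^ ((s.filter (fun t => t < j)).card + 1)) * X j) •
          fOf K n M k u (s.erase j)),
      Finset.sum_attach s (fun j => (((-1 : Rp K n) ^ ((s.filter (fun t => t < j)).card + 1)) *
            monomial ((u + Finsupp.single j 1) -
              bFun n M (u + Finsupp.single j 1)) (1 : K)) •
          fOf K n M k (bFun n M (u + Finsupp.single j 1)) (s.erase j)),
      ← Finset.sum_sub_distrib, ekT]
  refine Finset.sum_congr rfl fun j _ => ?_
  rw [smul_sub, smul_smul, smul_smul]
  rfl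

theorem ek_dFI_succ (k : ℕ) : dFI K n M (k+1) = ekD K M k :=
  congrArg (fun F => Finsupp.lift (FIdx n M k →₀ Rp K n) (Rp K n) (FIdx n M (k+1)) F)
    (funext fun p => ek_T_attach K M k p.1.1 p.1.2)

variable {M}

theorem ek_idx {k : ℕ} {u : Fin n →₀ ℕ} {s : Finset (Fin n)} (hu : IsMinGen n M u)
    (hs : s.card = k) (h : ∀ j ∈ s, ∃ t ∈ u.support, j < t) :
    ∃ p : FIdx n M k, p.1.1 = u ∧ p.1.2 = s :=
  ⟨⟨(u, s), hu, hs, h⟩, rfl, rfl⟩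

theorem ek_idx_ext {k : ℕ} {p q : FIdx n M k} (h1 : p.1.1 = q.1.1) (h2 : p.1.2 = q.1.2) :
    p = q := Subtype.ext (Prod.ext h1 h2)

theorem ek_fOf_single {k : ℕ} (p : FIdx n M k) :
    fOf K n M k p.1.1 p.1.2 = Finsupp.single p 1 := by
  rw [fOf, dif_pos p.2]
  rfl

theorem ek_fOf_apply {k : ℕ} (u : Fin n →₀ ℕ) (s : Finset (Fin n)) (q : FIdx n M k) :
    fOf K n M k u s q = if q.1 = (u, s) then 1 else 0 := by
  split_ifs with h
  · have : fOf K n M k u s = fOf K n M k q.1.1 q.1.2 := by rw [h]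
    rw [this, ek_fOf_single, Finsupp.single_eq_same]
  · by_cases h' : IsMinGen n M u ∧ s.card = k ∧ ∀ j ∈ s, ∃ t ∈ u.support, j < t
    · obtain ⟨p, rfl, rfl⟩ := ek_idx h'.1 h'.2.1 h'.2.2
      rw [ek_fOf_single, Finsupp.single_apply, if_neg]
      rintro rfl
      exact h rfl
    · rw [fOf, dif_neg h']
      rfl

theorem ekD_single {k : ℕ} (p : FIdx n M (k+1)) (f : Rp K n) :
    ekD K M k (Finsupp.single p f) = f • ekT K M k p.1.1 p.1.2 := by
  simp [ekD]

theorem ekD_fOf (hMI : MonomialIdeal n M) (hB : BorelFixed n M) {k : ℕ} {u : Fin n →₀ ℕ}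
    (hu : IsMinGen n M u) {s : Finset (Fin n)} (hs : s.card = k + 1) :
    ekD K M k (fOf K n M (k+1) u s) = ekT K M k u s := by
  by_cases h : ∀ j ∈ s, ∃ t ∈ u.support, j < t
  · obtain ⟨p, rfl, rfl⟩ := ek_idx hu hs h
    rw [ek_fOf_single, ekD_single, one_smul]
  · rw [fOf, dif_neg (by tauto), map_zero, ekT]
    symm
    push Not at h
    obtain ⟨t, hts, ht⟩ := h
    apply Finset.sum_eq_zero
    intro j hj
    by_cases hju : ∀ r ∈ u.support, r ≤ j
    · have hb := ek_b_self hu j hju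
      have hw : ekw M u j = Finsupp.single j 1 := by
        rw [ekw, hb, add_tsub_cancel_left]
      rw [hb, hw]
      simp [X]
    · push Not at hju
      obtain ⟨r, hr, hjr⟩ := hju
      have hjt : j < t := hjr.trans_le (ht r hr)
      have hte : t ∈ s.erase j := Finset.mem_erase.mpr ⟨hjt.ne', hts⟩
      rw [fOf, dif_neg, fOf, dif_neg]
      · simp
      · rintro ⟨_, _, h3⟩
        obtain ⟨l, hl, hlt⟩ := h3 t hte
        have := ek_b_le (ek_b_spec hMI hB (hMI _ hu.1 (Finsupp.single j 1))) l
        have hl' : bFun n M (u + Finsupp.single j 1) l ≠ 0 := by simpa using hl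
        have h4 : u l ≠ 0 ∨ j = l := by
          by_contra hcon
          push Not at hcon
          simp [hcon.1, Finsupp.single_apply, hcon.2] at this
          exact hl' this
        rcases h4 with h4 | h4
        · exact absurd (ht l (by simpa using h4)) (not_le.mpr hlt)
        · subst h4; exact absurd hlt (not_lt.mpr hjt.le)
      · rintro ⟨_, _, h3⟩
        obtain ⟨l, hl, hlt⟩ := h3 t hte
        exact absurd (ht l hl) (not_le.mpr hlt)

theorem ekw_spec (hMI : MonomialIdeal n M) (hB : BorelFixed n M) {u : Fin n →₀ ℕ}
    (hu : u ∈ M) (j : Fin n) :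
    bFun n M (u + Finsupp.single j 1) + ekw M u j = u + Finsupp.single j 1 :=
  add_tsub_cancel_of_le (ek_b_le (ek_b_spec hMI hB (hMI _ hu (Finsupp.single j 1))))

theorem ekD_ekT (hMI : MonomialIdeal n M) (hB : BorelFixed n M) {k : ℕ} {u : Fin n →₀ ℕ}
    (hu : IsMinGen n M u) {s : Finset (Fin n)} (hs : s.card = k + 2) :
    ekD K M k (ekT K M (k+1) u s) = 0 := by
  have hb1 : ∀ j, IsMinGen n M (bFun n M (u + Finsupp.single j 1)) := fun j =>
    (ek_b_spec hMI hB (hMI _ hu.1 (Finsupp.single j 1))).1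
  have hbb : ∀ i j, bFun n M (bFun n M (u + Finsupp.single j 1) + Finsupp.single i 1)
      = bFun n M (u + Finsupp.single j 1 + Finsupp.single i 1) := fun i j =>
    ek_b_b hMI hB (hMI _ hu.1 _) i
  let Q : Fin n → Fin n → (FIdx n M k →₀ Rp K n) := fun j i =>
    (X j : Rp K n) • ((X i : Rp K n) • fOf K n M k u ((s.erase j).erase i)
      - (monomial (ekw M u i) (1 : K) : Rp K n) •
        fOf K n M k (bFun n M (u + Finsupp.single i 1)) ((s.erase j).erase i))
    - (monomial (ekw M u j) (1 : K) : Rp K n) •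
      ((X i : Rp K n) • fOf K n M k (bFun n M (u + Finsupp.single j 1)) ((s.erase j).erase i)
      - (monomial (ekw M (bFun n M (u + Finsupp.single j 1)) i) (1 : K) : Rp K n) •
        fOf K n M k (bFun n M (bFun n M (u + Finsupp.single j 1) + Finsupp.single i 1))
          ((s.erase j).erase i))
  have hQ : ∀ i j, Q i j = Q j i := by
    intro i j
    have e1 : (s.erase i).erase j = (s.erase j).erase i := Finset.erase_right_comm
    have e2 : u + Finsupp.single i 1 + Finsupp.single j 1
      = u + Finsupp.single j 1 + Finsupp.single i 1 := add_right_comm _ _ _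
    have e3 : ekw M u i + ekw M (bFun n M (u + Finsupp.single i 1)) j
        = ekw M u j + ekw M (bFun n M (u + Finsupp.single j 1)) i := by
      have a1 := ekw_spec hMI hB hu.1 i
      have a2 := ekw_spec hMI hB hu.1 j
      have a3 := ekw_spec hMI hB (hb1 i).1 j
      have a4 := ekw_spec hMI hB (hb1 j).1 i
      rw [hbb, e2] at a3
      rw [hbb] at a4
      ext r
      have a1 := DFunLike.congr_fun a1 r
      have a2 := DFunLike.congr_fun a2 r
      have a3 := DFunLike.congr_fun a3 r
      have a4 := DFunLike.congr_fun a4 r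
      simp only [Finsupp.add_apply] at a1 a2 a3 a4 ⊢
      omega
    simp only [Q, hbb, e1, e2, smul_sub, smul_smul, monomial_mul, e3, mul_one]
    rw [mul_comm (X j : Rp K n) (X i : Rp K n), mul_comm (X j : Rp K n) (monomial _ _),
      mul_comm (X i : Rp K n) (monomial _ _)]
    abel
  have hexp : ekD K M k (ekT K M (k+1) u s)
      = ∑ j ∈ s, ∑ i ∈ s.erase j, (ekSg K s j * ekSg K (s.erase j) i) • Q j i := by
    rw [ekT, map_sum]
    refine Finset.sum_congr rfl fun j hj => ?_
    have hc : (s.erase j).card = k + 1 := by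
      rw [Finset.card_erase_of_mem hj, hs]; rfl
    rw [map_smul, map_sub, map_smul, map_smul, ekD_fOf K hMI hB hu hc,
      ekD_fOf K hMI hB (hb1 j) hc, ekT, ekT, Finset.smul_sum, Finset.smul_sum,
      ← Finset.sum_sub_distrib, Finset.smul_sum]
    refine Finset.sum_congr rfl fun i hi => ?_
    rw [mul_smul]
    congr 1
    rw [smul_comm (X j : Rp K n), smul_comm (monomial (ekw M u j) (1 : K) : Rp K n) (ekSg K _ _),
      ← smul_sub]
  rw [hexp, Finset.sum_sigma']
  refine Finset.sum_involution (fun x _ => ⟨x.2, x.1⟩) ?_ ?_ ?_ ?_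
  · rintro ⟨j, i⟩ h
    simp only [Finset.mem_sigma, Finset.mem_erase] at h
    simp only
    rw [hQ i j, ekSg_swap K h.2.2 h.1 h.2.1, neg_smul, neg_add_cancel]
  · rintro ⟨j, i⟩ h _ heq
    simp only [Finset.mem_sigma, Finset.mem_erase] at h
    simp at heq
    exact h.2.1 heq.1
  · rintro ⟨j, i⟩ h
    simp only [Finset.mem_sigma, Finset.mem_erase] at h ⊢
    exact ⟨h.2.2, fun e => h.2.1 e.symm, h.1⟩
  · rintro ⟨j, i⟩ h
    rfl

theorem ekD_ekD (hMI : MonomialIdeal n M) (hB : BorelFixed n M) (k : ℕ) 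
    (z : FIdx n M (k+2) →₀ Rp K n) : ekD K M k (ekD K M (k+1) z) = 0 := by
  induction z using Finsupp.induction_linear with
  | zero => simp
  | add f g hf hg => rw [map_add, map_add, hf, hg, add_zero]
  | single p f =>
    rw [ekD_single, map_smul, ekD_ekT K hMI hB p.2.1 p.2.2.1, smul_zero]

theorem ekD0_single (p : FIdx n M 0) (f : Rp K n) :
    ekD0 K M (Finsupp.single p f) = f * monomial p.1.1 (1 : K) := by
  simp [ekD0]

theorem ekD0_fOf {u : Fin n →₀ ℕ} (hu : IsMinGen n M u) :
    ekD0 K M (fOf K n M 0 u ∅) = monomial u (1 : K) := by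
  obtain ⟨p, rfl, hp⟩ := ek_idx (k := 0) (s := ∅) hu rfl (by simp)
  rw [← hp, ek_fOf_single, ekD0_single, one_mul]

theorem ekD0_ekD (hMI : MonomialIdeal n M) (hB : BorelFixed n M)
    (z : FIdx n M 1 →₀ Rp K n) : ekD0 K M (ekD K M 0 z) = 0 := by
  induction z using Finsupp.induction_linear with
  | zero => simp
  | add f g hf hg => rw [map_add, map_add, hf, hg, add_zero]
  | single p f =>
    obtain ⟨hu, hs, hl⟩ := p.2
    rw [ekD_single]
    generalize p.1.1 = u at *
    generalize p.1.2 = s at *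
    obtain ⟨j, rfl⟩ := Finset.card_eq_one.mp hs
    have hb1 : IsMinGen n M (bFun n M (u + Finsupp.single j 1)) :=
      (ek_b_spec hMI hB (hMI _ hu.1 (Finsupp.single j 1))).1
    rw [map_smul, ekT]
    simp only [Finset.sum_singleton, map_smul, map_sub]
    have he : ({j} : Finset (Fin n)).erase j = ∅ := by simp
    rw [he, ekD0_fOf K hu, ekD0_fOf K hb1, smul_eq_mul, smul_eq_mul, smul_eq_mul, smul_eq_mul,
      monomial_mul, add_comm (ekw M u j), ekw_spec hMI hB hu.1 j, X, monomial_mul,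
      add_comm (Finsupp.single j 1)]
    simp

end EKcx

section EKex

variable {n} {M : Set (Fin n →₀ ℕ)}

/-- basis elements `x^a (u;s)` to be eliminated -/
def ekDown (u : Fin n →₀ ℕ) (s : Finset (Fin n)) (a : Fin n →₀ ℕ) : Prop :=
  ∃ j, a j ≠ 0 ∧ (∃ t ∈ u.support, j < t) ∧ ∀ i ∈ s, i < j

variable (M) in
/-- elements without eliminable basis elements -/
def ekU (k : ℕ) : AddSubgroup (FIdx n M k →₀ Rp K n) where
  carrier := {z | ∀ p a, ekDown p.1.1 p.1.2 a → coeff a (z p) = 0}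
  zero_mem' := by intro p a _; simp
  add_mem' := by
    intro x y hx hy p a h
    rw [Finsupp.add_apply, coeff_add, hx p a h, hy p a h, add_zero]
  neg_mem' := by
    intro x hx p a h
    rw [Finsupp.neg_apply, coeff_neg, hx p a h, neg_zero]

theorem ekU_single {k : ℕ} (p : FIdx n M k) (a : Fin n →₀ ℕ) (c : K)
    (h : ¬ ekDown p.1.1 p.1.2 a) : Finsupp.single p (monomial a c : Rp K n) ∈ ekU K M k := by
  intro q a' h'
  rw [Finsupp.single_apply]
  split_ifs with hp
  · subst hp
    rw [coeff_monomial, if_neg]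
    rintro rfl
    exact h h'
  · simp

variable (M) in
/-- image plus reduced elements -/
def ekS (k : ℕ) : AddSubgroup (FIdx n M k →₀ Rp K n) :=
  (LinearMap.range (ekD K M k)).toAddSubgroup ⊔ ekU K M k

theorem ekS_sg {k : ℕ} {s : Finset (Fin n)} {j : Fin n} {z : FIdx n M k →₀ Rp K n} :
    ekSg K s j • z ∈ ekS K M k ↔ z ∈ ekS K M k := by
  unfold ekSg
  rcases neg_one_pow_eq_or (Rp K n) ((s.filter (fun t => t < j)).card + 1) with h | h
  · rw [h, one_smul]
  · rw [h, neg_one_smul, neg_mem_iff]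

theorem ek_smul_fOf {k : ℕ} (p : FIdx n M k) (f : Rp K n) :
    f • fOf K n M k p.1.1 p.1.2 = Finsupp.single p f := by
  rw [ek_fOf_single, Finsupp.smul_single, smul_eq_mul, mul_one]

theorem ek_reduce (hMI : MonomialIdeal n M) (hB : BorelFixed n M) (k : ℕ) :
    ∀ (N : ℕ) (u : Fin n →₀ ℕ) (s : Finset (Fin n)) (a : Fin n →₀ ℕ) (c : K), ekW u = N →
      (monomial a c : Rp K n) • fOf K n M k u s ∈ ekS K M k := by
  intro N
  induction N using Nat.strong_induction_on with
  | _ N ih =>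
  intro u s a c hN
  by_cases hleg : IsMinGen n M u ∧ s.card = k ∧ ∀ j ∈ s, ∃ t ∈ u.support, j < t
  swap
  · rw [fOf, dif_neg hleg, smul_zero]
    exact zero_mem _
  by_cases hd : ekDown u s a
  swap
  · obtain ⟨p, rfl, rfl⟩ := ek_idx hleg.1 hleg.2.1 hleg.2.2
    rw [ek_smul_fOf]
    exact AddSubgroup.mem_sup_right (ekU_single K p a c hd)
  obtain ⟨hu, hs, hl⟩ := hleg
  -- choose the maximal j
  let J : Finset (Fin n) := Finset.univ.filter fun j =>
    a j ≠ 0 ∧ (∃ t ∈ u.support, j < t) ∧ ∀ i ∈ s, i < j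
  have hJ : J.Nonempty := by
    obtain ⟨j, hj⟩ := hd
    exact ⟨j, by simpa [J] using hj⟩
  obtain ⟨j, hjJ, hjmax⟩ : ∃ j ∈ J, ∀ r ∈ J, r ≤ j :=
    ⟨J.max' hJ, Finset.max'_mem _ _, fun r hr => Finset.le_max' _ _ hr⟩
  have hj := (Finset.mem_filter.mp hjJ).2
  obtain ⟨haj, hju, hjs⟩ := hj
  have hjns : j ∉ s := fun h => lt_irrefl _ (hjs j h)
  have hcard : (insert j s).card = k + 1 := by rw [Finset.card_insert_of_notMem hjns, hs]
  have hlj : ∀ i ∈ insert j s, ∃ t ∈ u.support, i < t := by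
    intro i hi
    rcases Finset.mem_insert.mp hi with rfl | hi
    · exact hju
    · exact hl i hi
  obtain ⟨a', rfl⟩ : ∃ a', a = a' + Finsupp.single j 1 :=
    ⟨a - Finsupp.single j 1, by
      rw [tsub_add_cancel_of_le]
      rw [Finsupp.single_le_iff]
      omega⟩
  have hmem : (monomial a' c : Rp K n) • ekT K M k u (insert j s) ∈ ekS K M k := by
    apply AddSubgroup.mem_sup_left
    refine ⟨(monomial a' c : Rp K n) • fOf K n M (k+1) u (insert j s), ?_⟩
    rw [map_smul, ekD_fOf K hMI hB hu hcard]
  -- mu terms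
  have hmu : ∀ i ∈ insert j s, (monomial a' c : Rp K n) •
      ((monomial (ekw M u i) (1 : K) : Rp K n) •
      fOf K n M k (bFun n M (u + Finsupp.single i 1)) ((insert j s).erase i)) ∈ ekS K M k := by
    intro i hi
    rw [smul_smul, monomial_mul]
    exact ih _ (hN ▸ ekW_lt hMI hB hu (hlj i hi)) _ _ _ _ rfl
  have hde : ∀ i ∈ s, (monomial a' c : Rp K n) •
      ((X i : Rp K n) • fOf K n M k u ((insert j s).erase i)) ∈ ekS K M k := by
    intro i hi
    have hij : i < j := hjs i hi
    rw [smul_smul, X, monomial_mul]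
    obtain ⟨p, hp1, hp2⟩ := ek_idx (M := M) (k := k) (s := (insert j s).erase i) hu
      (by rw [Finset.card_erase_of_mem (Finset.mem_insert_of_mem hi), hcard]; rfl)
      (fun r hr => hlj r (Finset.mem_of_mem_erase hr))
    rw [← hp1, ← hp2, ek_smul_fOf]
    refine AddSubgroup.mem_sup_right (ekU_single K p _ _ ?_)
    rw [hp1, hp2]
    rintro ⟨r, hr1, hr2, hr3⟩
    have hjr : j < r := hr3 j (Finset.mem_erase.mpr ⟨hij.ne', Finset.mem_insert_self _ _⟩)
    have hir : i ≠ r := (hij.trans hjr).ne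
    have hrJ : r ∈ J := by
      refine Finset.mem_filter.mpr ⟨Finset.mem_univ _, ?_, hr2, fun l hl' => (hjs l hl').trans hjr⟩
      simp [Finsupp.single_apply, hir] at hr1
      simp [hr1]
    exact absurd (hjmax r hrJ) (not_le.mpr hjr)
  rw [ekT, Finset.smul_sum, Finset.sum_insert hjns] at hmem
  have hrest : ∑ i ∈ s, (monomial a' c : Rp K n) • (ekSg K (insert j s) i •
      ((X i : Rp K n) • fOf K n M k u ((insert j s).erase i)
      - (monomial (ekw M u i) (1 : K) : Rp K n) •
      fOf K n M k (bFun n M (u + Finsupp.single i 1)) ((insert j s).erase i))) ∈ ekS K M k := by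
    refine sum_mem fun i hi => ?_
    rw [smul_comm, ekS_sg, smul_sub]
    exact sub_mem (hde i hi) (hmu i (Finset.mem_insert_of_mem hi))
  have h1 := (add_mem_cancel_right hrest).mp hmem
  rw [smul_comm, ekS_sg, smul_sub] at h1
  have h2 := add_mem h1 (hmu j (Finset.mem_insert_self _ _))
  rw [sub_add_cancel, Finset.erase_insert hjns, smul_smul, X, monomial_mul, mul_one] at h2
  exact h2

theorem ek_mem_S (hMI : MonomialIdeal n M) (hB : BorelFixed n M) (k : ℕ)
    (z : FIdx n M k →₀ Rp K n) : z ∈ ekS K M k := by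
  induction z using Finsupp.induction_linear with
  | zero => exact zero_mem _
  | add f g hf hg => exact add_mem hf hg
  | single p f =>
    induction f using MvPolynomial.induction_on' with
    | monomial a c =>
      rw [← ek_smul_fOf]
      exact ek_reduce K hMI hB k _ _ _ _ _ rfl
    | add f g hf hg => rw [Finsupp.single_add]; exact add_mem hf hg

theorem ekD_apply {k : ℕ} (z : FIdx n M (k+1) →₀ Rp K n) (q : FIdx n M k) :
    ekD K M k z q = ∑ p ∈ z.support, z p * ekT K M k p.1.1 p.1.2 q := by
  rw [ekD, Finsupp.lift_apply, Finsupp.sum, Finsupp.finsetSum_apply]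
  rfl

theorem ekT_apply {k : ℕ} (u : Fin n →₀ ℕ) (s : Finset (Fin n)) (q : FIdx n M k) :
    ekT K M k u s q = ∑ i ∈ s, ekSg K s i * (X i * (if q.1 = (u, s.erase i) then 1 else 0)
      - monomial (ekw M u i) (1 : K) * 
        (if q.1 = (bFun n M (u + Finsupp.single i 1), s.erase i) then 1 else 0)) := by
  rw [ekT, Finsupp.finsetSum_apply]
  refine Finset.sum_congr rfl fun i _ => ?_
  rw [Finsupp.smul_apply, Finsupp.sub_apply, Finsupp.smul_apply, Finsupp.smul_apply,
    ek_fOf_apply, ek_fOf_apply]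
  rfl

theorem ekSg_coeff {s : Finset (Fin n)} {i : Fin n} (f : Rp K n) (m : Fin n →₀ ℕ) :
    coeff m (ekSg K s i * f) = 0 ↔ coeff m f = 0 := by
  unfold ekSg
  rcases neg_one_pow_eq_or (Rp K n) ((s.filter (fun t => t < i)).card + 1) with h | h
  · rw [h, one_mul]
  · rw [h, neg_one_mul, coeff_neg, neg_eq_zero]

theorem ek_inj (hMI : MonomialIdeal n M) (hB : BorelFixed n M) (k : ℕ)
    (z : FIdx n M (k+1) →₀ Rp K n) (hz : z ∈ ekU K M (k+1)) (hd : ekD K M k z = 0) :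
    z = 0 := by
  by_contra hne
  obtain ⟨p, hp, hpmax⟩ := Finset.exists_max_image z.support
    (fun p : FIdx n M (k+1) => ekW p.1.1) (Finsupp.support_nonempty_iff.mpr hne)
  have hzp : z p ≠ 0 := Finsupp.mem_support_iff.mp hp
  obtain ⟨a, ha⟩ := MvPolynomial.ne_zero_iff.mp hzp
  have hnd : ¬ ekDown p.1.1 p.1.2 a := fun h => ha (hz p a h)
  obtain ⟨hu, hs, hl⟩ := p.2
  have hsne : p.1.2.Nonempty := Finset.card_pos.mp (by omega)
  obtain ⟨j, hjs, hjmax⟩ : ∃ j ∈ p.1.2, ∀ r ∈ p.1.2, r ≤ j :=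
    ⟨p.1.2.max' hsne, Finset.max'_mem _ _, fun r hr => Finset.le_max' _ _ hr⟩
  obtain ⟨q, hq1, hq2⟩ := ek_idx (M := M) (k := k) (s := p.1.2.erase j) hu
      (by rw [Finset.card_erase_of_mem hjs, hs]; rfl)
      (fun r hr => hl r (Finset.mem_of_mem_erase hr))
  have hq : q.1 = (p.1.1, p.1.2.erase j) := Prod.ext hq1 hq2
  have hmu : ∀ p' ∈ z.support, ∀ i ∈ p'.1.2,
      ¬ (q.1 = (bFun n M (p'.1.1 + Finsupp.single i 1), p'.1.2.erase i)) := by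
    intro p' hp' i hi h
    have h1 : p.1.1 = bFun n M (p'.1.1 + Finsupp.single i 1) := by
      rw [← hq1, h]
    have h2 := ekW_lt hMI hB p'.2.1 (p'.2.2.2 i hi)
    have h3 := hpmax p' hp'
    rw [← h1] at h2
    omega
  have hform : ∀ p' ∈ z.support, ekT K M k p'.1.1 p'.1.2 q
      = ∑ i ∈ p'.1.2, ekSg K p'.1.2 i *
        (X i * (if q.1 = (p'.1.1, p'.1.2.erase i) then 1 else 0)) := by
    intro p' hp'
    rw [ekT_apply]
    refine Finset.sum_congr rfl fun i hi => ?_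
    rw [if_neg (hmu p' hp' i hi), mul_zero, sub_zero]
  have h0 : coeff (a + Finsupp.single j 1) (ekD K M k z q) = 0 := by
    rw [hd]; simp
  rw [ekD_apply, coeff_sum, Finset.sum_eq_single p] at h0
  · rw [hform p hp, Finset.sum_eq_single j, if_pos hq, mul_one, mul_left_comm, ekSg_coeff,
      coeff_mul_X] at h0
    · exact ha h0
    · intro i hi hij
      rw [if_neg]
      · simp
      · rw [hq]
        intro h
        have h' := congrArg Prod.snd h
        simp only at h'
        have : i ∈ p.1.2.erase i := by
          rw [← h']; exact Finset.mem_erase.mpr ⟨hij, hi⟩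
        exact Finset.notMem_erase _ _ this
    · intro h; exact absurd hjs h
  · intro p' hp' hpp
    rw [hform p' hp', Finset.mul_sum, coeff_sum]
    apply Finset.sum_eq_zero
    intro i hi
    split_ifs with h
    swap
    · simp
    rw [hq] at h
    have e1 : p.1.1 = p'.1.1 := (Prod.mk.inj h).1
    have e2 : p.1.2.erase j = p'.1.2.erase i := (Prod.mk.inj h).2
    have hij : i ≠ j := by
      rintro rfl
      apply hpp
      apply ek_idx_ext e1.symm
      rw [← Finset.insert_erase hi, ← e2, Finset.insert_erase hjs]
    have hi' : i ∉ p.1.2 := by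
      intro hh
      have : i ∈ p'.1.2.erase i := by
        rw [← e2]; exact Finset.mem_erase.mpr ⟨hij, hh⟩
      exact Finset.notMem_erase _ _ this
    have hiu : ∃ t ∈ p.1.1.support, i < t := by
      rw [e1]; exact p'.2.2.2 i hi
    rw [mul_one, mul_left_comm, ekSg_coeff, coeff_mul_X']
    split_ifs with hia
    swap
    · rfl
    have hai : a i ≠ 0 := by
      simp [Finsupp.single_apply, hij.symm] at hia
      exact hia
    rcases lt_or_gt_of_ne hij with hlt | hgt
    · apply hz
      refine ⟨j, ?_, ?_, ?_⟩
      · simp [Finsupp.single_apply, hij]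
      · rw [← e1]; exact hl j hjs
      · intro r hr
        by_cases hri : r = i
        · rwa [hri]
        · have : r ∈ p.1.2.erase j := by rw [e2]; exact Finset.mem_erase.mpr ⟨hri, hr⟩
          exact lt_of_le_of_ne (hjmax r (Finset.mem_of_mem_erase this)) (Finset.ne_of_mem_erase this)
    · exfalso
      exact hnd ⟨i, hai, hiu, fun r hr => (hjmax r hr).trans_lt hgt⟩
  · intro h; exact absurd hp h

theorem ekD0_apply (z : FIdx n M 0 →₀ Rp K n) :
    ekD0 K M z = ∑ p ∈ z.support, z p * monomial p.1.1 (1 : K) := by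
  rw [ekD0, Finsupp.lift_apply, Finsupp.sum]
  rfl

theorem ek_inj0 (z : FIdx n M 0 →₀ Rp K n) (hz : z ∈ ekU K M 0) (hd : ekD0 K M z = 0) :
    z = 0 := by
  by_contra hne
  obtain ⟨p, hp⟩ := Finsupp.support_nonempty_iff.mpr hne
  have hzp : z p ≠ 0 := Finsupp.mem_support_iff.mp hp
  obtain ⟨a, ha⟩ := MvPolynomial.ne_zero_iff.mp hzp
  have hemp : ∀ p : FIdx n M 0, p.1.2 = ∅ := fun p => Finset.card_eq_zero.mp p.2.2.1
  have key : ∀ (p : FIdx n M 0) a, coeff a (z p) ≠ 0 → IsBeginning n M (a + p.1.1) p.1.1 := by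
    intro p a ha
    refine ⟨p.2.1, a, add_comm _ _, ?_⟩
    intro i hi j hj
    by_contra hcon
    exact ha (hz p a ⟨j, by simpa using hj, ⟨i, hi, not_le.mp hcon⟩, by simp [hemp p]⟩)
  have h0 : coeff (a + p.1.1) (ekD0 K M z) = 0 := by rw [hd]; simp
  rw [ekD0_apply, coeff_sum, Finset.sum_eq_single p, coeff_mul_monomial, mul_one] at h0
  · exact ha h0
  · intro p' hp' hpp
    rw [coeff_mul_monomial', mul_one]
    split_ifs with hle
    swap
    · rfl
    by_contra hc
    have h1 := key p' _ hc
    rw [tsub_add_cancel_of_le hle] at h1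
    have h2 := ek_beg_unique h1 (key p a ha)
    exact hpp (ek_idx_ext h2 (by rw [hemp, hemp]))
  · intro h; exact absurd hp h

theorem ek_exact (hMI : MonomialIdeal n M) (hB : BorelFixed n M) (k : ℕ)
    (z : FIdx n M (k+1) →₀ Rp K n) (hd : ekD K M k z = 0) :
    ∃ y, ekD K M (k+1) y = z := by
  obtain ⟨x, ⟨y, rfl⟩, w, hw, rfl⟩ := AddSubgroup.mem_sup.mp (ek_mem_S K hMI hB (k+1) z)
  rw [map_add, ekD_ekD K hMI hB, zero_add] at hd
  refine ⟨y, ?_⟩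
  rw [ek_inj K hMI hB k w hw hd, add_zero]

theorem ek_exact0 (hMI : MonomialIdeal n M) (hB : BorelFixed n M)
    (z : FIdx n M 0 →₀ Rp K n) (hd : ekD0 K M z = 0) :
    ∃ y, ekD K M 0 y = z := by
  obtain ⟨x, ⟨y, rfl⟩, w, hw, rfl⟩ := AddSubgroup.mem_sup.mp (ek_mem_S K hMI hB 0 z)
  rw [map_add, ekD0_ekD K hMI hB, zero_add] at hd
  refine ⟨y, ?_⟩
  rw [ek_inj0 K w hw hd, add_zero]

theorem ek_range0 (hMI : MonomialIdeal n M) (hB : BorelFixed n M) :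
    LinearMap.range (ekD0 K M) =
      Ideal.span ((fun α => (monomial α (1 : K) : Rp K n)) '' M) := by
  apply le_antisymm
  · rintro _ ⟨z, rfl⟩
    rw [ekD0_apply]
    refine sum_mem fun p _ => Ideal.mul_mem_left _ _ (Ideal.subset_span ⟨_, p.2.1.1, rfl⟩)
  · rw [Ideal.span, Submodule.span_le]
    rintro _ ⟨g, hg, rfl⟩
    obtain ⟨hu, v, hv, _⟩ := ek_b_spec hMI hB hg
    refine ⟨(monomial v (1 : K) : Rp K n) • fOf K n M 0 (bFun n M g) ∅, ?_⟩
    rw [map_smul, ekD0_fOf K hu, smul_eq_mul, monomial_mul, mul_one, add_comm, ← hv]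

theorem ek_mon_mem {v : Fin n →₀ ℕ} (hv : v ≠ 0) :
    (monomial v (1 : K) : Rp K n) ∈ Ideal.span (Set.range (X : Fin n → Rp K n)) := by
  obtain ⟨j, hj⟩ := Finsupp.ne_iff.mp hv
  have hj' : v j ≠ 0 := hj
  have : (monomial v (1 : K) : Rp K n) = monomial (v - Finsupp.single j 1) 1 * X j := by
    rw [X, monomial_mul, tsub_add_cancel_of_le, mul_one]
    rw [Finsupp.single_le_iff]; omega
  rw [this]
  exact Ideal.mul_mem_left _ _ (Ideal.subset_span ⟨j, rfl⟩)

theorem ek_min0 (h0 : 0 ∉ M) : LinearMap.range (ekD0 K M) ≤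
    (Ideal.span (Set.range (X : Fin n → Rp K n))) • (⊤ : Submodule (Rp K n) (Rp K n)) := by
  rintro _ ⟨z, rfl⟩
  rw [ekD0_apply]
  refine sum_mem fun p _ => ?_
  rw [mul_comm]
  refine Submodule.smul_mem_smul (ek_mon_mem K ?_) trivial
  intro h
  exact h0 (h ▸ p.2.1.1)

theorem ek_min (hMI : MonomialIdeal n M) (hB : BorelFixed n M) (k : ℕ) :
    LinearMap.range (ekD K M k) ≤
    (Ideal.span (Set.range (X : Fin n → Rp K n))) •
      (⊤ : Submodule (Rp K n) (FIdx n M k →₀ Rp K n)) := by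
  rintro _ ⟨z, rfl⟩
  rw [ekD, Finsupp.lift_apply, Finsupp.sum]
  refine sum_mem fun p _ => Submodule.smul_mem _ _ ?_
  rw [ekT]
  refine sum_mem fun j hj => Submodule.smul_mem _ _ (sub_mem ?_ ?_)
  · exact Submodule.smul_mem_smul (Ideal.subset_span ⟨j, rfl⟩) trivial
  · refine Submodule.smul_mem_smul (ek_mon_mem K ?_) trivial
    intro h
    have h1 := ekw_spec hMI hB p.2.1.1 j
    rw [h, add_zero] at h1
    have h2 := ekW_lt hMI hB p.2.1 (p.2.2.2 j hj)
    rw [h1, ekW_add] at h2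
    omega

end EKex

/-- Let `I ⊆ R = k[x_1, …, x_n]` be a (proper) Borel-fixed monomial
ideal, given by its set `M` of exponent vectors.  Then the Eliahou–Kervaire complex
`F_I`, with differential `d = ∂ - μ`, is a minimal free resolution of `R/I`:
* `d ∘ d = 0`;
* it is exact in positive homological degrees, and the image of `(F_I)_1 → R` is `I`
  (the ideal spanned by the monomials of `M`), so the complex resolves `R/I`;
* minimality: all differentials have entries in the maximal ideal `(x_1, …, x_n)`. -/
theorem EK_resolution_of_Borel_fixed (hn : 1 ≤ n) (M : Set (Fin n →₀ ℕ))
    (hMI : MonomialIdeal n M) (hB : BorelFixed n M) (hproper : 0 ∉ M) :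
    -- F_I is a complex
    (∀ k, (dFI K n M k).comp (dFI K n M (k+1)) = 0) ∧
    -- exactness at (F_I)_{k+1} for every k
    (∀ k, LinearMap.ker (dFI K n M k) = LinearMap.range (dFI K n M (k+1))) ∧
    -- the cokernel of (F_I)_1 → R is R/I
    (LinearMap.range (dFI K n M 0) =
      Ideal.span ((fun α => (monomial α (1 : K) : Rp K n)) '' M)) ∧
    -- minimality
    (∀ k, LinearMap.range (dFI K n M k) ≤
      (Ideal.span (Set.range (X : Fin n → Rp K n))) •
        (⊤ : Submodule (Rp K n) (FImod K n M k))) := by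
  refine ⟨?_, ?_, ?_, ?_⟩
  · rintro (_ | k)
    · rw [ek_dFI_succ, ek_dFI_zero]
      exact LinearMap.ext fun z => ekD0_ekD K hMI hB z
    · rw [ek_dFI_succ, ek_dFI_succ]
      exact LinearMap.ext fun z => ekD_ekD K hMI hB k z
  · rintro (_ | k)
    · rw [ek_dFI_succ, ek_dFI_zero]
      apply le_antisymm
      · intro z hz
        exact ek_exact0 K hMI hB z hz
      · rintro _ ⟨y, rfl⟩
        exact ekD0_ekD K hMI hB y
    · rw [ek_dFI_succ, ek_dFI_succ]
      apply le_antisymm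
      · intro z hz
        exact ek_exact K hMI hB k z hz
      · rintro _ ⟨y, rfl⟩
        exact ekD_ekD K hMI hB k y
  · rw [ek_dFI_zero]
    exact ek_range0 K hMI hB
  · rintro (_ | k)
    · rw [ek_dFI_zero]
      exact ek_min0 K hproper
    · rw [ek_dFI_succ]
      exact ek_min K hMI hB k

end
end

section
/- Let m = (x_1,…,x_n) and d ≥ 1. The R-module homomorphisms η_{k+1} : EK_{k+1} → (F_{m^d})_{k+1} sending a basis tableau T with column entries i_1 < ⋯ < i_k and row entries j_1 ≤ ⋯ ≤ j_d (with i_k < j_d) to the Eliahou–Kervaire basis symbol (x_{j_1}⋯x_{j_d}; i_1,…,i_k) form an isomorphism of complexes η_• : EK_• → F_{m^d}. -/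
open Finset MvPolynomial

attribute [local instance] Classical.propDecidable

noncomputable section

variable (K : Type) [Field K] (n : ℕ)

/-- A multiset of size `d+1` over `Fin n` is nonempty. -/
lemma symNe {d : ℕ} (m : Sym (Fin n) (d+1)) :
    (m : Multiset (Fin n)).toFinset.Nonempty := by
  rw [Multiset.toFinset_nonempty]
  intro h
  have hm := Sym.card_coe (s := m)
  rw [h] at hm
  simp at hm

/-- The largest entry `j_d` of a (sorted) nonempty row `j_1 ≤ ⋯ ≤ j_d`. -/
def maxSym {d : ℕ} (m : Sym (Fin n) (d+1)) : Fin n :=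
  (m : Multiset (Fin n)).toFinset.max' (symNe n m)

lemma maxSym_mem {d : ℕ} (m : Sym (Fin n) (d+1)) :
    maxSym n m ∈ (m : Multiset (Fin n)) :=
  Multiset.mem_toFinset.mp (Finset.max'_mem _ (symNe n m))

/-- The smallest entry `j_1` of a (sorted) nonempty row `j_1 ≤ ⋯ ≤ j_d`. -/
def minSym {d : ℕ} (m : Sym (Fin n) (d+1)) : Fin n :=
  (m : Multiset (Fin n)).toFinset.min' (symNe n m)

lemma minSym_mem {d : ℕ} (m : Sym (Fin n) (d+1)) :
    minSym n m ∈ (m : Multiset (Fin n)) :=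
  Multiset.mem_toFinset.mp (Finset.min'_mem _ (symNe n m))

/-- Basis index set for `EK_{k+1}`: hook tableaux with strictly increasing column
entries `i_1 < ⋯ < i_k` (a `k`-element subset) and row entries `j_1 ≤ ⋯ ≤ j_d`
(a multiset of size `d`, here `d = d+1 ≥ 1`), subject to `i_k < j_d`. -/
def EKIdx (d k : ℕ) : Type :=
  {p : Finset (Fin n) × Sym (Fin n) (d+1) //
    p.1.card = k ∧ ∀ i ∈ p.1, i < maxSym n p.2}

/-- The terms of the complex `EK_•`: `EK_0 = R` and `EK_{k+1}` is free on the hook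
tableaux above. -/
def EKmod (d : ℕ) : ℕ → Type
  | 0 => Rp K n
  | k+1 => EKIdx n d k →₀ Rp K n

instance (d : ℕ) : (k : ℕ) → AddCommGroup (EKmod K n d k)
  | 0 => inferInstanceAs (AddCommGroup (Rp K n))
  | k+1 => inferInstanceAs (AddCommGroup (EKIdx n d k →₀ Rp K n))

instance (d : ℕ) : (k : ℕ) → Module (Rp K n) (EKmod K n d k)
  | 0 => inferInstanceAs (Module (Rp K n) (Rp K n))
  | k+1 => inferInstanceAs (Module (Rp K n) (EKIdx n d k →₀ Rp K n))

/-- The tableau with column `s` and row `m`, as a basis element of `EK_{k+1}` if it is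
a legal tableau (column of size `k`, all column entries < largest row entry), and `0`
otherwise (the standard Eliahou–Kervaire convention for illegal symbols). -/
def ekOf (d k : ℕ) (s : Finset (Fin n)) (m : Sym (Fin n) (d+1)) : EKIdx n d k →₀ Rp K n :=
  if h : s.card = k ∧ ∀ i ∈ s, i < maxSym n m then Finsupp.single ⟨(s, m), h⟩ 1 else 0

/-- The row `m` with its largest entry `j_d` removed and `i` inserted:
the row of the tableau `(T ∖ {i_ℓ, j_d})^{i_ℓ}`. -/
def rowSwap {d : ℕ} (i : Fin n) (m : Sym (Fin n) (d+1)) : Sym (Fin n) (d+1) :=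
  ⟨i ::ₘ (m : Multiset (Fin n)).erase (maxSym n m), by
    rw [Multiset.card_cons, Multiset.card_erase_of_mem (maxSym_mem n m), Sym.card_coe]; rfl⟩

/-- The monomial `x_{j_1} ⋯ x_{j_r}` attached to a multiset of indices. -/
def mprod (m : Multiset (Fin n)) : Rp K n := (m.map (fun i => X i)).prod

/-- The Eliahou–Kervaire differential `d_EK : EK_{k+1} → EK_k` (in the reformulation by
Young tableaux): a single-row tableau is sent to its monomial `x_{j_1} ⋯ x_{j_d}`, and
for `k > 0` a tableau `T` is sent to
`Σ_ℓ (-1)^ℓ x_{i_ℓ} (T∖i_ℓ) - Σ_ℓ (-1)^ℓ x_{j_d} (T∖{i_ℓ,j_d})^{i_ℓ}`. -/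
def dEK (d : ℕ) : (k : ℕ) → EKmod K n d (k+1) →ₗ[Rp K n] EKmod K n d k
  | 0 => Finsupp.lift _ _ _ fun p => mprod K n (p.1.2 : Multiset (Fin n))
  | k+1 => Finsupp.lift _ _ _ fun p =>
      (∑ i ∈ p.1.1.attach,
        (((-1 : Rp K n) ^ ((p.1.1.filter (fun j => j < i.1)).card + 1)) * X i.1) •
          ekOf K n d k (p.1.1.erase i.1) p.1.2)
      - (∑ i ∈ p.1.1.attach,
        (((-1 : Rp K n) ^ ((p.1.1.filter (fun j => j < i.1)).card + 1)) *
            X (maxSym n p.1.2)) •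
          ekOf K n d k (p.1.1.erase i.1) (rowSwap n i.1 p.1.2))

/-- The total degree of a monomial (exponent vector). -/
def fdeg (α : Fin n →₀ ℕ) : ℕ := α.sum fun _ e => e

/-- The set of exponent vectors of the monomial ideal `m^d = (x_1, …, x_n)^d`:
all monomials of total degree at least `d`. -/
def Mpow (d : ℕ) : Set (Fin n →₀ ℕ) := {α | d ≤ fdeg n α}

/-- The map `η`: in degree `0` the identity of `R`, and in degree `k+1` the map
sending a basis tableau with column `i_1 < ⋯ < i_k` (the finset `s`) and row
`j_1 ≤ ⋯ ≤ j_d` (the multiset `m`) to the Eliahou–Kervaire symbol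
`(x_{j_1} ⋯ x_{j_d}; i_1, …, i_k)` of `F_{m^d}`. -/
def etaMap (d : ℕ) : (k : ℕ) → EKmod K n d k →ₗ[Rp K n] FImod K n (Mpow n (d+1)) k
  | 0 => LinearMap.id
  | k+1 => Finsupp.lift _ _ _ fun p =>
      fOf K n (Mpow n (d+1)) k (Multiset.toFinsupp (p.1.2 : Multiset (Fin n))) p.1.1

lemma fdeg_eq (u : Fin n →₀ ℕ) : fdeg n u = u.degree := rfl

lemma isMinGen_iff (d : ℕ) (u : Fin n →₀ ℕ) : IsMinGen n (Mpow n d) u ↔ fdeg n u = d := by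
  unfold IsMinGen Mpow
  simp only [Set.mem_ofPred_eq, fdeg_eq]
  constructor
  · rintro ⟨h1, h2⟩
    by_contra hne
    have hu : u ≠ 0 := by
      rintro rfl
      simp at h1 hne
      omega
    obtain ⟨a, ha⟩ := Finsupp.ne_iff.mp hu
    have hle : Finsupp.single a 1 ≤ u := by
      rw [Finsupp.single_le_iff]
      exact Nat.one_le_iff_ne_zero.mpr ha
    obtain ⟨w, rfl⟩ := exists_add_of_le hle
    have hd : (Finsupp.single a 1 + w).degree = 1 + w.degree := by
      rw [map_add, Finsupp.degree_single]
    have := h2 w (by omega) le_add_self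
    have h3 := congrArg Finsupp.degree this
    omega
  · intro h
    refine ⟨h.ge, fun v hv hvu => ?_⟩
    obtain ⟨w, rfl⟩ := exists_add_of_le hvu
    rw [map_add] at h
    have hw : w.degree = 0 := by omega
    rw [Finsupp.degree_eq_zero_iff] at hw
    simp [hw]

lemma fdeg_sym {d : ℕ} (m : Sym (Fin n) d) :
    fdeg n (Multiset.toFinsupp (m : Multiset (Fin n))) = d := by
  unfold fdeg
  exact (Multiset.toFinsupp_sum_eq _).trans m.2

lemma lt_maxSym_iff {d : ℕ} (m : Sym (Fin n) (d+1)) (i : Fin n) :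
    i < maxSym n m ↔ ∃ t ∈ (Multiset.toFinsupp (m : Multiset (Fin n))).support, i < t := by
  rw [Multiset.toFinsupp_support]
  constructor
  · intro h
    exact ⟨_, Multiset.mem_toFinset.mpr (maxSym_mem n m), h⟩
  · rintro ⟨t, ht, h⟩
    exact lt_of_lt_of_le h (Finset.le_max' _ _ ht)

lemma le_maxSym {d : ℕ} (m : Sym (Fin n) (d+1)) (i : Fin n)
    (hi : i ∈ (m : Multiset (Fin n))) : i ≤ maxSym n m :=
  Finset.le_max' _ _ (Multiset.mem_toFinset.mpr hi)

lemma legal_iff (d k : ℕ) (s : Finset (Fin n)) (m : Sym (Fin n) (d+1)) :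
    (s.card = k ∧ ∀ i ∈ s, i < maxSym n m) ↔
    (IsMinGen n (Mpow n (d+1)) (Multiset.toFinsupp (m : Multiset (Fin n))) ∧ s.card = k ∧
      ∀ j ∈ s, ∃ t ∈ (Multiset.toFinsupp (m : Multiset (Fin n))).support, j < t) := by
  simp only [isMinGen_iff, fdeg_sym, lt_maxSym_iff, true_and]

def idxMap (d k : ℕ) (p : EKIdx n d k) : FIdx n (Mpow n (d+1)) k :=
  ⟨(Multiset.toFinsupp (p.1.2 : Multiset (Fin n)), p.1.1), (legal_iff n d k _ _).mp p.2⟩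

lemma idxMap_bij (d k : ℕ) : Function.Bijective (idxMap n d k) := by
  constructor
  · rintro ⟨⟨s, m⟩, hp⟩ ⟨⟨s', m'⟩, hp'⟩ h
    have h1 := congrArg Subtype.val h
    simp only [idxMap, Prod.mk.injEq, EmbeddingLike.apply_eq_iff_eq] at h1
    obtain ⟨h1, h2⟩ := h1
    have h1 := Sym.coe_injective h1
    subst h1 h2
    rfl
  · rintro ⟨⟨u, s⟩, hq⟩
    have hc : Multiset.card (Finsupp.toMultiset u) = d + 1 := by
      rw [Finsupp.card_toMultiset]
      exact (isMinGen_iff n (d+1) u).mp hq.1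
    have hu : Multiset.toFinsupp (Finsupp.toMultiset u) = u := by simp
    refine ⟨⟨(s, ⟨Finsupp.toMultiset u, hc⟩), (legal_iff n d k _ _).mpr ?_⟩, ?_⟩
    · show IsMinGen n _ (Multiset.toFinsupp (Finsupp.toMultiset u)) ∧ _ ∧
        ∀ j ∈ s, ∃ t ∈ (Multiset.toFinsupp (Finsupp.toMultiset u)).support, j < t
      rw [hu]
      exact hq
    · apply Subtype.ext
      exact Prod.ext hu rfl

lemma lift_single_aux {A R M : Type} [CommRing R] [AddCommGroup M] [Module R M]
    (f : A → M) (a : A) (r : R) :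
    (Finsupp.lift M R A f) (Finsupp.single a r) = r • f a := by
  rw [Finsupp.lift_apply, Finsupp.sum_single_index (by simp)]

lemma etaMap_single (d k : ℕ) (p : EKIdx n d k) (r : Rp K n) :
    etaMap K n d (k+1) (Finsupp.single p r : EKIdx n d k →₀ Rp K n) =
      (Finsupp.single (idxMap n d k p) r : FIdx n (Mpow n (d+1)) k →₀ Rp K n) := by
  have h1 : fOf K n (Mpow n (d+1)) k (Multiset.toFinsupp (p.1.2 : Multiset (Fin n))) p.1.1 =
      Finsupp.single (idxMap n d k p) 1 := by
    unfold fOf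
    exact dif_pos ((legal_iff n d k _ _).mp p.2)
  have h2 : r • fOf K n (Mpow n (d+1)) k (Multiset.toFinsupp (p.1.2 : Multiset (Fin n))) p.1.1 =
      Finsupp.single (idxMap n d k p) r := by
    rw [h1, Finsupp.smul_single, smul_eq_mul, mul_one]
  exact (lift_single_aux (R := Rp K n) (M := FIdx n (Mpow n (d+1)) k →₀ Rp K n)
    (fun p : EKIdx n d k => fOf K n (Mpow n (d+1)) k
      (Multiset.toFinsupp (p.1.2 : Multiset (Fin n))) p.1.1) p r).trans h2

lemma etaMap_bij (d k : ℕ) : Function.Bijective (etaMap K n d (k+1)) := by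
  have : ∀ x : EKIdx n d k →₀ Rp K n, etaMap K n d (k+1) x =
      Finsupp.domLCongr (R := Rp K n) (Equiv.ofBijective _ (idxMap_bij n d k)) x := by
    intro x
    have hl : (etaMap K n d (k+1) : (EKIdx n d k →₀ Rp K n) →ₗ[Rp K n]
        (FIdx n (Mpow n (d+1)) k →₀ Rp K n)) =
      (Finsupp.domLCongr (R := Rp K n) (Equiv.ofBijective _ (idxMap_bij n d k))).toLinearMap := by
      apply Finsupp.lhom_ext
      intro p r
      exact (etaMap_single K n d k p r).trans 
        (Finsupp.domLCongr_single (R := Rp K n) (M := Rp K n)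
          (Equiv.ofBijective _ (idxMap_bij n d k)) p r).symm
    exact LinearMap.congr_fun hl x
  have h2 : (etaMap K n d (k+1) : (EKIdx n d k →₀ Rp K n) → (FIdx n (Mpow n (d+1)) k →₀ Rp K n)) =
      Finsupp.domLCongr (R := Rp K n) (Equiv.ofBijective _ (idxMap_bij n d k)) := funext this
  exact h2 ▸ LinearEquiv.bijective _

lemma etaMap_ekOf (d k : ℕ) (s : Finset (Fin n)) (m : Sym (Fin n) (d+1)) :
    etaMap K n d (k+1) (ekOf K n d k s m) =
      fOf K n (Mpow n (d+1)) k (Multiset.toFinsupp (m : Multiset (Fin n))) s := by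
  unfold ekOf fOf
  by_cases h : s.card = k ∧ ∀ i ∈ s, i < maxSym n m
  · rw [dif_pos h, dif_pos ((legal_iff n d k _ _).mp h)]
    exact etaMap_single K n d k _ _
  · rw [dif_neg h, dif_neg (fun h' => h ((legal_iff n d k _ _).mpr h'))]
    exact map_zero _

lemma beginning_unique (d : ℕ) (g u u' : Fin n →₀ ℕ) (a : Fin n)
    (hu : IsMinGen n (Mpow n d) u) (hg : g = u + Finsupp.single a 1)
    (ha : ∀ i ∈ u.support, i ≤ a) (h' : IsBeginning n (Mpow n d) g u') : u' = u := by
  obtain ⟨hu', v, hv, hmax⟩ := h'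
  rw [isMinGen_iff, fdeg_eq] at hu hu'
  have hd := congrArg Finsupp.degree (hg.symm.trans hv)
  rw [map_add, map_add, Finsupp.degree_single] at hd
  have hv1 : v.degree = 1 := by omega
  obtain ⟨b, rfl⟩ : ∃ b, v = Finsupp.single b 1 := by
    have hv0 : v ≠ 0 := by
      rintro rfl
      simp at hv1
    obtain ⟨b, hb⟩ := Finsupp.ne_iff.mp hv0
    have hle : Finsupp.single b 1 ≤ v := by
      rw [Finsupp.single_le_iff]
      exact Nat.one_le_iff_ne_zero.mpr hb
    obtain ⟨w, rfl⟩ := exists_add_of_le hle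
    rw [map_add, Finsupp.degree_single] at hv1
    have hw : w.degree = 0 := by omega
    rw [Finsupp.degree_eq_zero_iff] at hw
    exact ⟨b, by simp [hw]⟩
  have he := hg.symm.trans hv
  by_cases hab : a = b
  · subst hab
    exact (add_right_cancel he).symm
  · exfalso
    have h1 := DFunLike.congr_fun he a
    have h2 := DFunLike.congr_fun he b
    simp [hab, Ne.symm hab] at h1 h2
    have hba : b ≤ a := ha b (by rw [Finsupp.mem_support_iff]; omega)
    have hab' : a ≤ b := hmax a (by rw [Finsupp.mem_support_iff]; omega) b (by simp)
    exact hab (le_antisymm hab' hba)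

lemma rowSwap_add {d : ℕ} (m : Sym (Fin n) (d+1)) (i : Fin n) :
    Multiset.toFinsupp (m : Multiset (Fin n)) + Finsupp.single i 1 =
      Multiset.toFinsupp (rowSwap n i m : Multiset (Fin n)) + Finsupp.single (maxSym n m) 1 := by
  rw [← Multiset.toFinsupp_singleton, ← Multiset.toFinsupp_singleton, ← map_add, ← map_add]
  congr 1
  show _ = i ::ₘ (m : Multiset (Fin n)).erase (maxSym n m) + {maxSym n m}
  conv_lhs => rw [← Multiset.cons_erase (maxSym_mem n m)]
  simp only [← Multiset.singleton_add]
  abel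

lemma bFun_eq {d : ℕ} (m : Sym (Fin n) (d+1)) (i : Fin n) (hi : i < maxSym n m) :
    bFun n (Mpow n (d+1)) (Multiset.toFinsupp (m : Multiset (Fin n)) + Finsupp.single i 1) =
      Multiset.toFinsupp (rowSwap n i m : Multiset (Fin n)) := by
  have hmg : IsMinGen n (Mpow n (d+1))
      (Multiset.toFinsupp (rowSwap n i m : Multiset (Fin n))) :=
    (isMinGen_iff n _ _).mpr (fdeg_sym n _)
  have hmax : ∀ j ∈ (Multiset.toFinsupp (rowSwap n i m : Multiset (Fin n))).support,
      j ≤ maxSym n m := by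
    intro j hj
    rw [Multiset.toFinsupp_support, Multiset.mem_toFinset] at hj
    change j ∈ i ::ₘ (m : Multiset (Fin n)).erase (maxSym n m) at hj
    rcases Multiset.mem_cons.mp hj with rfl | hj
    · exact hi.le
    · exact le_maxSym n m j (Multiset.mem_of_mem_erase hj)
  have hex : ∃ u, IsBeginning n (Mpow n (d+1))
      (Multiset.toFinsupp (m : Multiset (Fin n)) + Finsupp.single i 1) u := by
    refine ⟨_, hmg, _, rowSwap_add n m i, ?_⟩
    intro j hj t ht
    rw [Finsupp.support_single _ one_ne_zero, Finset.mem_singleton] at ht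
    rw [ht]
    exact hmax j hj
  unfold bFun
  rw [dif_pos hex]
  exact beginning_unique n _ _ _ _ _ hmg (rowSwap_add n m i) hmax hex.choose_spec

lemma mprod_eq (m : Multiset (Fin n)) :
    mprod K n m = monomial (Multiset.toFinsupp m) (1 : K) := by
  unfold mprod
  induction m using Multiset.induction_on with
  | empty => simp
  | cons a s ih =>
    rw [Multiset.map_cons, Multiset.prod_cons, ih, ← Multiset.singleton_add, map_add,
      Multiset.toFinsupp_singleton, X, monomial_mul, one_mul]

lemma comm_zero (d : ℕ) : (etaMap K n d 0).comp (dEK K n d 0) =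
      (dFI K n (Mpow n (d+1)) 0).comp (etaMap K n d 1) := by
  refine Finsupp.lhom_ext (M := Rp K n) (α := EKIdx n d 0) fun p r => ?_
  have h1 : r • mprod K n (p.1.2 : Multiset (Fin n)) =
      r • (monomial (idxMap n d 0 p).1.1 (1 : K) : Rp K n) := by
    rw [mprod_eq]
    rfl
  refine Eq.trans ?_ (congrArg (dFI K n (Mpow n (d+1)) 0) (etaMap_single K n d 0 p r)).symm
  refine (lift_single_aux (R := Rp K n) (M := Rp K n)
    (fun p : EKIdx n d 0 => mprod K n (p.1.2 : Multiset (Fin n))) p r).trans (h1.trans ?_)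
  exact (lift_single_aux (R := Rp K n) (M := Rp K n)
    (fun p : FIdx n (Mpow n (d+1)) 0 => (monomial p.1.1 (1 : K) : Rp K n)) _ r).symm

def dEKb (d k : ℕ) (p : EKIdx n d (k+1)) : EKIdx n d k →₀ Rp K n :=
  (∑ i ∈ p.1.1.attach,
        (((-1 : Rp K n) ^ ((p.1.1.filter (fun j => j < i.1)).card + 1)) * X i.1) •
          ekOf K n d k (p.1.1.erase i.1) p.1.2)
      - (∑ i ∈ p.1.1.attach,
        (((-1 : Rp K n) ^ ((p.1.1.filter (fun j => j < i.1)).card + 1)) *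
            X (maxSym n p.1.2)) •
          ekOf K n d k (p.1.1.erase i.1) (rowSwap n i.1 p.1.2))

def dFIb (M : Set (Fin n →₀ ℕ)) (k : ℕ) (u : Fin n →₀ ℕ) (s : Finset (Fin n)) :
    FIdx n M k →₀ Rp K n :=
  (∑ j ∈ s.attach,
        (((-1 : Rp K n) ^ ((s.filter (fun t => t < j.1)).card + 1)) * X j.1) •
          fOf K n M k u (s.erase j.1))
      - (∑ j ∈ s.attach,
        (((-1 : Rp K n) ^ ((s.filter (fun t => t < j.1)).card + 1)) *
            monomial ((u + Finsupp.single j.1 1) -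
              bFun n M (u + Finsupp.single j.1 1)) (1 : K)) •
          fOf K n M k (bFun n M (u + Finsupp.single j.1 1)) (s.erase j.1))

lemma eta_dEKb (d k : ℕ) (p : EKIdx n d (k+1))
    (E : (EKIdx n d k →₀ Rp K n) →ₗ[Rp K n] (FIdx n (Mpow n (d+1)) k →₀ Rp K n))
    (hE : ∀ s m, E (ekOf K n d k s m) =
      fOf K n (Mpow n (d+1)) k (Multiset.toFinsupp (m : Multiset (Fin n))) s) :
    E (dEKb K n d k p) = dFIb K n (Mpow n (d+1)) k
      (Multiset.toFinsupp (p.1.2 : Multiset (Fin n))) p.1.1 := by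
  unfold dEKb dFIb
  rw [map_sub, map_sum, map_sum]
  simp only [map_smul, hE]
  refine congrArg₂ (fun a b => a - b) rfl (Finset.sum_congr rfl fun i _ => ?_)
  have hi : i.1 < maxSym n p.1.2 := p.2.2 _ i.2
  rw [bFun_eq n _ _ hi, rowSwap_add, add_tsub_cancel_left]
  have hX : (X (maxSym n p.1.2) : Rp K n) =
    monomial (Finsupp.single (maxSym n p.1.2) 1) (1 : K) := rfl
  rw [hX]

lemma comm_succ (d k : ℕ) : (etaMap K n d (k+1)).comp (dEK K n d (k+1)) =
      (dFI K n (Mpow n (d+1)) (k+1)).comp (etaMap K n d (k+1+1)) := by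
  refine Finsupp.lhom_ext (M := Rp K n) (α := EKIdx n d (k+1)) fun p r => ?_
  have h1 : dEK K n d (k+1) (Finsupp.single p r : EKIdx n d (k+1) →₀ Rp K n) =
      r • dEKb K n d k p :=
    lift_single_aux (R := Rp K n) (M := EKIdx n d k →₀ Rp K n) (dEKb K n d k) p r
  have h2 : dFI K n (Mpow n (d+1)) (k+1)
      (Finsupp.single (idxMap n d (k+1) p) r : FIdx n (Mpow n (d+1)) (k+1) →₀ Rp K n) =
      r • dFIb K n (Mpow n (d+1)) k (Multiset.toFinsupp (p.1.2 : Multiset (Fin n))) p.1.1 :=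
    lift_single_aux (R := Rp K n) (M := FIdx n (Mpow n (d+1)) k →₀ Rp K n)
      (fun q : FIdx n (Mpow n (d+1)) (k+1) => dFIb K n (Mpow n (d+1)) k q.1.1 q.1.2)
      (idxMap n d (k+1) p) r
  let E : (EKIdx n d k →₀ Rp K n) →ₗ[Rp K n] (FIdx n (Mpow n (d+1)) k →₀ Rp K n) :=
    etaMap K n d (k+1)
  have h3 : E (r • dEKb K n d k p) =
      r • dFIb K n (Mpow n (d+1)) k (Multiset.toFinsupp (p.1.2 : Multiset (Fin n))) p.1.1 := by
    rw [map_smul, eta_dEKb K n d k p E (etaMap_ekOf K n d k)]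
  refine Eq.trans ?_ (congrArg (dFI K n (Mpow n (d+1)) (k+1))
    (etaMap_single K n d (k+1) p r)).symm
  exact ((congrArg (etaMap K n d (k+1)) h1).trans h3).trans h2.symm

/-- (The paper's `d ≥ 1` is written `d+1`.)  The maps `η_k` form an
isomorphism of complexes `η : EK_• → F_{m^d}` between the tableau complex `EK_•` and
the Eliahou–Kervaire resolution of the Borel-fixed ideal `m^d = (x_1, …, x_n)^d`:
each `η_k` is bijective and `η` commutes with the differentials. -/
theorem eta_iso_of_complexes (hn : 1 ≤ n) (d : ℕ) :
    (∀ k, Function.Bijective (etaMap K n d k)) ∧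
    (∀ k, (etaMap K n d k).comp (dEK K n d k) =
      (dFI K n (Mpow n (d+1)) k).comp (etaMap K n d (k+1))) := by
  refine ⟨fun k => ?_, fun k => ?_⟩
  · cases k with
    | zero => exact Function.bijective_id
    | succ k => exact etaMap_bij K n d k
  · cases k with
    | zero => exact comm_zero K n d
    | succ k => exact comm_succ K n d k

end
end

section
/- Let I be a Borel-fixed monomial ideal of R and let g ∈ I be a monomial. Then there is exactly one factorization g = u·v with u a minimal monomial generator of I, v a monomial, and max(u) ≤ min(v). -/
open Finset MvPolynomial

attribute [local instance] Classical.propDecidable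

noncomputable section

variable (K : Type) [Field K] (n : ℕ)

theorem beginning_exists_aux (M : Set (Fin n →₀ ℕ))
    (hMI : MonomialIdeal n M) (hB : BorelFixed n M)
    (g : Fin n →₀ ℕ) (hg : g ∈ M) :
    ∃ u v : Fin n →₀ ℕ, IsMinGen n M u ∧ g = u + v ∧
        ∀ i ∈ u.support, ∀ j ∈ v.support, i ≤ j := by
  induction g using WellFoundedLT.induction with
  | ind g ih =>
  by_cases hm : IsMinGen n M g
  · exact ⟨g, 0, hm, by simp, by simp⟩
  have h1 : ∃ w ∈ M, w ≤ g ∧ w ≠ g := by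
    by_contra hcon
    push Not at hcon
    exact hm ⟨hg, fun v hv hle => hcon v hv hle⟩
  obtain ⟨w, hw, hle, hne⟩ := h1
  have h2 : ∃ j, w j < g j := by
    by_contra hcon
    push Not at hcon
    exact hne (le_antisymm hle hcon)
  obtain ⟨j, hj⟩ := h2
  have hjs : j ∈ g.support := by
    rw [Finsupp.mem_support_iff]; omega
  have hjM : g - Finsupp.single j 1 ∈ M := by
    have : w ≤ g - Finsupp.single j 1 := by
      intro t
      have := hle t
      by_cases h : j = t
      · subst h; simp; omega
      · simp [Finsupp.single_apply, h]; omega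
    have h3 := hMI w hw (g - Finsupp.single j 1 - w)
    rwa [add_tsub_cancel_of_le this] at h3
  set m := g.support.max' ⟨j, hjs⟩ with hmdef
  have hms : m ∈ g.support := Finset.max'_mem _ _
  have hmax : ∀ t ∈ g.support, t ≤ m := fun t ht => Finset.le_max' _ t ht
  clear_value m
  rw [Finsupp.mem_support_iff] at hms hjs
  have hmM : g - Finsupp.single m 1 ∈ M := by
    rcases eq_or_ne j m with h | h
    · rwa [← h]
    have hjm : j < m := lt_of_le_of_ne (hmax j (by simpa using hjs)) h
    have e1 : g - Finsupp.single j 1 - Finsupp.single m 1 + Finsupp.single m 1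
        = g - Finsupp.single j 1 := by
      ext t
      simp only [Finsupp.add_apply, Finsupp.tsub_apply, Finsupp.single_apply]
      split_ifs <;> grind
    have e2 : g - Finsupp.single j 1 - Finsupp.single m 1 + Finsupp.single j 1
        = g - Finsupp.single m 1 := by
      ext t
      simp only [Finsupp.add_apply, Finsupp.tsub_apply, Finsupp.single_apply]
      split_ifs <;> grind
    rw [← e2]
    apply hB _ j m hjm
    rwa [e1]
  have e3 : g - Finsupp.single m 1 + Finsupp.single m 1 = g := by
    ext t
    simp only [Finsupp.add_apply, Finsupp.tsub_apply, Finsupp.single_apply]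
    split_ifs <;> grind
  have hlt : g - Finsupp.single m 1 < g := by
    refine lt_of_le_of_ne tsub_le_self fun h => ?_
    have := DFunLike.congr_fun h m
    simp at this
    omega
  obtain ⟨u, v, hu, huv, hs⟩ := ih _ hlt hmM
  have hg' : g = u + (v + Finsupp.single m 1) := by rw [← add_assoc, ← huv, e3]
  refine ⟨u, v + Finsupp.single m 1, hu, hg', ?_⟩
  intro i hi t ht
  by_cases h : m = t
  · subst h
    apply hmax
    rw [Finsupp.mem_support_iff] at hi ⊢
    rw [hg']
    simp only [Finsupp.add_apply]
    omega
  · apply hs i hi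
    simpa [Finsupp.single_apply, h] using ht

theorem beginning_le_aux (u v u' v' : Fin n →₀ ℕ) (h : u + v = u' + v')
    (h1 : ∀ i ∈ u.support, ∀ j ∈ v.support, i ≤ j)
    (h2 : ∀ i ∈ u'.support, ∀ j ∈ v'.support, i ≤ j) : u ≤ u' ∨ u' ≤ u := by
  by_contra hcon
  rw [not_or, Finsupp.le_def, Finsupp.le_def] at hcon
  push Not at hcon
  obtain ⟨⟨j, hj⟩, ⟨i, hi⟩⟩ := hcon
  have ei := DFunLike.congr_fun h i
  have ej := DFunLike.congr_fun h j
  simp only [Finsupp.add_apply] at ei ej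
  have a := h1 j (by rw [Finsupp.mem_support_iff]; omega) i
    (by rw [Finsupp.mem_support_iff]; omega)
  have b := h2 i (by rw [Finsupp.mem_support_iff]; omega) j
    (by rw [Finsupp.mem_support_iff]; omega)
  have := le_antisymm a b
  subst this
  omega

/-- Let `I` be a Borel-fixed monomial ideal of `R` (given by its set
`M` of exponent vectors) and let `g ∈ I` be a monomial.  Then there is exactly one
factorization `g = u · v` (i.e. `g = u + v` of exponent vectors) with `u` a minimal
monomial generator of `I`, `v` a monomial, and `max(u) ≤ min(v)` (every variable
occurring in `u` has index at most that of every variable occurring in `v`, which is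
vacuous when `u = 1` or `v = 1`, matching `max(1) = 0`, `min(1) = +∞`). -/
theorem beginning_exists_unique (hn : 1 ≤ n) (M : Set (Fin n →₀ ℕ))
    (hMI : MonomialIdeal n M) (hB : BorelFixed n M)
    (g : Fin n →₀ ℕ) (hg : g ∈ M) :
    ∃! p : (Fin n →₀ ℕ) × (Fin n →₀ ℕ),
      IsMinGen n M p.1 ∧ g = p.1 + p.2 ∧
        ∀ i ∈ p.1.support, ∀ j ∈ p.2.support, i ≤ j := by
  obtain ⟨u, v, hu, hg1, hs⟩ := beginning_exists_aux n M hMI hB g hg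
  refine ⟨(u, v), ⟨hu, hg1, hs⟩, ?_⟩
  rintro ⟨u', v'⟩ ⟨hu', hg2, hs'⟩
  dsimp only at hu' hg2 hs'
  have hE : u' = u := by
    rcases beginning_le_aux n u v u' v' (hg1.symm.trans hg2) hs hs' with h | h
    · exact (hu'.2 u hu.1 h).symm
    · exact hu.2 u' hu'.1 h
  subst hE
  have := add_left_cancel (hg1.symm.trans hg2)
  rw [this]

end
end
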